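/- arXiv:math/0108212 — 2 statements merged into one kernel-verified Lean document; each statement's English description precedes it below -/
import Mathlib

section
/- Let μ be a finite measure on ℝⁿ of the form dμ(x) = p(x)dx where p : ℝⁿ → [0,∞) is logarithmically concave (i.e., p(tx+(1−t)y) ≥ p(x)^t p(y)^{1−t} for all x, y ∈ ℝⁿ and t ∈ [0,1]). Let F ⊆ ℝⁿ be a compact convex set with 0 < μ(F) < ∞, let E ⊆ F be closed, and let λ > 1. Then μ(E_{λ,F})/μ(F) ≤ (μ(E)/μ(F))^λ. -/
open MeasureTheory

/-- The one-dimensional Lebesgue measure of the intersection of a set `E` with the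
segment from `a` to `b`, computed via the affine parametrization of the segment. -/
noncomputable def segmentMeasure {n : ℕ} (E : Set (EuclideanSpace ℝ (Fin n)))
    (a b : EuclideanSpace ℝ (Fin n)) : ℝ :=
  dist a b * (volume {t : ℝ | t ∈ Set.Icc (0 : ℝ) 1 ∧ a + t • (b - a) ∈ E}).toReal

/-- The core `E_{λ,F}` : the set of points `x ∈ E` such that for every segment `J`
with `x ∈ J ⊆ F`, the one-dimensional measure of `E ∩ J` is at least `((λ-1)/λ)·|J|`. -/
noncomputable def core {n : ℕ} (E F : Set (EuclideanSpace ℝ (Fin n))) (lam : ℝ) :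
    Set (EuclideanSpace ℝ (Fin n)) :=
  {x | x ∈ E ∧ ∀ a b : EuclideanSpace ℝ (Fin n),
    x ∈ segment ℝ a b → segment ℝ a b ⊆ F →
      ((lam - 1) / lam) * dist a b ≤ segmentMeasure E a b}

section

open Set Filter Topology

theorem lintegral_eq_lintegral_measure_lt {α : Type*} [MeasurableSpace α] (μ : Measure α)
    {f : α → ENNReal} (hf : Measurable f) (hfin : ∀ᵐ x ∂μ, f x ≠ ⊤) :
    ∫⁻ x, f x ∂μ = ∫⁻ s in Ioi (0 : ℝ), μ {x | ENNReal.ofReal s < f x} := by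
  have h1 := lintegral_eq_lintegral_meas_lt μ (f := fun x => (f x).toReal)
    (Eventually.of_forall fun x => ENNReal.toReal_nonneg) hf.ennreal_toReal.aemeasurable
  have h2 : ∫⁻ x, ENNReal.ofReal (f x).toReal ∂μ = ∫⁻ x, f x ∂μ :=
    lintegral_congr_ae (hfin.mono fun x hx => ENNReal.ofReal_toReal hx)
  rw [← h2, h1]
  refine setLIntegral_congr_fun measurableSet_Ioi fun s hs => ?_
  refine measure_congr ?_
  filter_upwards [hfin] with x hx
  exact propext (ENNReal.ofReal_lt_iff_lt_toReal (le_of_lt hs) hx).symm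

theorem measurable_measure_lt {α : Type*} [MeasurableSpace α] (μ : Measure α) (f : α → ENNReal) :
    Measurable fun s : ℝ => μ {x | ENNReal.ofReal s < f x} := by
  refine Antitone.measurable fun s t hst => measure_mono fun x hx => ?_
  exact lt_of_le_of_lt (ENNReal.ofReal_le_ofReal hst) hx

theorem ennreal_add_le_of_forall_lt {a b c : ENNReal} (ha : a ≠ 0) (hb : b ≠ 0)
    (h : ∀ a' < a, ∀ b' < b, a' + b' ≤ c) : a + b ≤ c := by
  have h1 : ∀ a' < a, a' + b ≤ c := fun a' ha' => by
    refine le_of_forall_lt fun d hd => ?_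
    by_cases hda : d < a'
    · exact lt_of_lt_of_le hda (le_trans le_self_add (h a' ha' 0 (pos_iff_ne_zero.2 hb)))
    · push Not at hda
      obtain ⟨e, rfl⟩ := exists_add_of_le hda
      have hfin : a' ≠ ⊤ := ne_top_of_lt ha'
      have heb : e < b := lt_of_add_lt_add_left hd
      obtain ⟨e', h3, h4⟩ := exists_between heb
      exact lt_of_lt_of_le (ENNReal.add_lt_add_left hfin h3) (h a' ha' e' h4)
  refine le_of_forall_lt fun d hd => ?_
  by_cases hdb : d < b
  · refine lt_of_lt_of_le hdb ?_
    simpa using h1 0 (pos_iff_ne_zero.2 ha)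
  · push Not at hdb
    obtain ⟨e, rfl⟩ := exists_add_of_le hdb
    rw [add_comm a b] at hd
    have hea : e < a := lt_of_add_lt_add_left hd
    obtain ⟨e', h3, h4⟩ := exists_between hea
    have hbfin : b ≠ ⊤ := fun hb' => by simp [hb'] at hd
    rw [add_comm b e]
    exact lt_of_lt_of_le (ENNReal.add_lt_add_right hbfin h3) (h1 e' h4)

theorem volume_add_le_of_isCompact {A B C : Set ℝ} (hA : IsCompact A) (hB : IsCompact B)
    (hA' : A.Nonempty) (hB' : B.Nonempty) (hC : ∀ a ∈ A, ∀ b ∈ B, a + b ∈ C) :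
    volume A + volume B ≤ volume C := by
  have ha := hA.sSup_mem hA'
  have hb := hB.sInf_mem hB'
  set a := sSup A
  set b := sInf B
  have e1 : volume ((fun x => -b + x) ⁻¹' A) = volume A := measure_preimage_add _ _ _
  have e2 : volume ((fun x => -a + x) ⁻¹' B) = volume B := measure_preimage_add _ _ _
  have m2 : MeasurableSet ((fun x => -a + x) ⁻¹' B) :=
    hB.measurableSet.preimage (measurable_const_add _)
  have e3 : volume ((fun x => -a + x) ⁻¹' B \ {a + b}) = volume B := by
    rw [measure_sdiff_null (by simp), e2]
  rw [← e1, ← e3, ← measure_union _ (m2.diff (measurableSet_singleton _))]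
  · refine measure_mono ?_
    rintro x (hx | ⟨hx, -⟩)
    · simpa using hC _ hx _ hb
    · simpa using hC _ ha _ hx
  · refine Set.disjoint_left.2 fun x hx hx' => hx'.2 ?_
    have h1 : -b + x ≤ a := le_csSup hA.bddAbove hx
    have h2 : b ≤ -a + x := csInf_le hB.bddBelow hx'.1
    simp only [mem_singleton_iff]
    linarith

/-- The one-dimensional Brunn-Minkowski inequality. -/
theorem volume_add_le {A B C : Set ℝ} (hA : MeasurableSet A) (hB : MeasurableSet B)
    (hA' : A.Nonempty) (hB' : B.Nonempty) (hC : ∀ a ∈ A, ∀ b ∈ B, a + b ∈ C) :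
    volume A + volume B ≤ volume C := by
  by_cases hA0 : volume A = 0
  · obtain ⟨a, ha⟩ := hA'
    have e2 : volume ((fun x => -a + x) ⁻¹' B) = volume B := measure_preimage_add _ _ _
    rw [hA0, zero_add, ← e2]
    exact measure_mono fun x hx => by simpa using hC _ ha _ hx
  by_cases hB0 : volume B = 0
  · obtain ⟨b, hb⟩ := hB'
    have e2 : volume ((fun x => -b + x) ⁻¹' A) = volume A := measure_preimage_add _ _ _
    rw [hB0, add_zero, ← e2]
    exact measure_mono fun x hx => by simpa using hC _ hx _ hb
  refine ennreal_add_le_of_forall_lt hA0 hB0 fun a ha b hb => ?_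
  obtain ⟨K, hKA, hK, hK'⟩ := hA.exists_lt_isCompact ha
  obtain ⟨L, hLB, hL, hL'⟩ := hB.exists_lt_isCompact hb
  refine le_trans (add_le_add hK'.le hL'.le) (volume_add_le_of_isCompact hK hL ?_ ?_
    fun a ha b hb => hC a (hKA ha) b (hLB hb))
  · exact nonempty_of_measure_ne_zero (ne_of_gt (lt_of_le_of_lt (zero_le) hK'))
  · exact nonempty_of_measure_ne_zero (ne_of_gt (lt_of_le_of_lt (zero_le) hL'))

theorem volume_convexCombo_le {A B C : Set ℝ} (hA : MeasurableSet A) (hB : MeasurableSet B)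
    (hA' : A.Nonempty) (hB' : B.Nonempty) {t : ℝ} (ht : 0 < t) (ht1 : t < 1)
    (hC : ∀ a ∈ A, ∀ b ∈ B, t * a + (1 - t) * b ∈ C) :
    ENNReal.ofReal t * volume A + ENNReal.ofReal (1 - t) * volume B ≤ volume C := by
  have key := volume_add_le (C := C) (hA.const_smul₀ t) (hB.const_smul₀ (1 - t))
    (hA'.smul_set) (hB'.smul_set) (by
      rintro _ ⟨a, ha, rfl⟩ _ ⟨b, hb, rfl⟩
      exact hC a ha b hb)
  rw [Measure.addHaar_smul, Measure.addHaar_smul] at key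
  simpa [abs_of_pos ht, abs_of_pos (sub_pos.2 ht1)] using key

theorem ennreal_rpow_mul_rpow_le {t : ℝ} (ht : 0 < t) (ht1 : t < 1) (x y : ENNReal) :
    x ^ t * y ^ (1 - t) ≤ ENNReal.ofReal t * x + ENNReal.ofReal (1 - t) * y := by
  have h1t : 0 < 1 - t := sub_pos.2 ht1
  by_cases hx : x = ⊤
  · simp [hx, ENNReal.mul_top, ht]
  by_cases hy : y = ⊤
  · simp [hy, ENNReal.mul_top, ht1]
  lift x to NNReal using hx
  lift y to NNReal using hy
  have := NNReal.geom_mean_le_arith_mean2_weighted ⟨t, ht.le⟩ ⟨1 - t, h1t.le⟩ x y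
    (by apply NNReal.eq; change t + (1 - t) = 1; ring)
  rw [← ENNReal.coe_rpow_of_nonneg _ ht.le, ← ENNReal.coe_rpow_of_nonneg _ h1t.le,
    ENNReal.ofReal, ENNReal.ofReal, Real.toNNReal_of_nonneg ht.le, Real.toNNReal_of_nonneg h1t.le]
  exact_mod_cast this

/-- The Prékopa-Leindler inequality on the line for functions with supremum one. -/
theorem prekopaLeindler_real_of_iSup_eq_one {f g h : ℝ → ENNReal} (hf : Measurable f)
    (hg : Measurable g) (hh : Measurable h) {t : ℝ} (ht : 0 < t) (ht1 : t < 1)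
    (hf1 : ⨆ x, f x = 1) (hg1 : ⨆ x, g x = 1)
    (H : ∀ x y, f x ^ t * g y ^ (1 - t) ≤ h (t * x + (1 - t) * y)) :
    ENNReal.ofReal t * (∫⁻ x, f x) + ENNReal.ofReal (1 - t) * (∫⁻ x, g x) ≤ ∫⁻ x, h x := by
  have h1t : 0 < 1 - t := sub_pos.2 ht1
  have hfle : ∀ x, f x ≤ 1 := fun x => hf1 ▸ le_iSup f x
  have hgle : ∀ x, g x ≤ 1 := fun x => hg1 ▸ le_iSup g x
  have hle : ∫⁻ x, min (h x) 1 ≤ ∫⁻ x, h x := lintegral_mono fun x => min_le_left _ _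
  refine le_trans ?_ hle
  rw [lintegral_eq_lintegral_measure_lt volume hf
      (Eventually.of_forall fun x => ((hfle x).trans_lt ENNReal.one_lt_top).ne),
    lintegral_eq_lintegral_measure_lt volume hg
      (Eventually.of_forall fun x => ((hgle x).trans_lt ENNReal.one_lt_top).ne),
    lintegral_eq_lintegral_measure_lt volume (hh.min measurable_const)
      (Eventually.of_forall fun x => ((min_le_right _ _).trans_lt ENNReal.one_lt_top).ne),
    ← lintegral_const_mul _ (measurable_measure_lt _ _),
    ← lintegral_const_mul _ (measurable_measure_lt _ _),
    ← lintegral_add_left ((measurable_measure_lt _ _).const_mul _)]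
  refine setLIntegral_mono' measurableSet_Ioi fun s hs => ?_
  by_cases hs1 : ENNReal.ofReal s < 1
  · refine volume_convexCombo_le (measurableSet_lt measurable_const hf)
      (measurableSet_lt measurable_const hg)
      (let ⟨x, hx⟩ := lt_iSup_iff.1 (hf1 ▸ hs1); ⟨x, hx⟩)
      (let ⟨x, hx⟩ := lt_iSup_iff.1 (hg1 ▸ hs1); ⟨x, hx⟩) ht ht1 fun a ha b hb => ?_
    refine lt_min (lt_of_lt_of_le ?_ (H a b)) hs1
    have e : ENNReal.ofReal s = ENNReal.ofReal s ^ t * ENNReal.ofReal s ^ (1 - t) := by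
      rw [← ENNReal.rpow_add _ _ (by simpa using hs) ENNReal.ofReal_ne_top]
      simp
    rw [e]
    exact ENNReal.mul_lt_mul (ENNReal.rpow_lt_rpow ha ht) (ENNReal.rpow_lt_rpow hb h1t)
  · have e1 : {x | ENNReal.ofReal s < f x} = ∅ := by
      ext x; simpa using (hfle x).trans (not_lt.1 hs1)
    have e2 : {x | ENNReal.ofReal s < g x} = ∅ := by
      ext x; simpa using (hgle x).trans (not_lt.1 hs1)
    simp [e1, e2]

theorem prekopaLeindler_real_of_bounded {f g h : ℝ → ENNReal} (hf : Measurable f)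
    (hg : Measurable g) (hh : Measurable h) {t : ℝ} (ht : 0 < t) (ht1 : t < 1)
    (hf1 : ⨆ x, f x ≠ ⊤) (hg1 : ⨆ x, g x ≠ ⊤)
    (H : ∀ x y, f x ^ t * g y ^ (1 - t) ≤ h (t * x + (1 - t) * y)) :
    (∫⁻ x, f x) ^ t * (∫⁻ x, g x) ^ (1 - t) ≤ ∫⁻ x, h x := by
  have h1t : 0 < 1 - t := sub_pos.2 ht1
  by_cases hf0 : ⨆ x, f x = 0
  · have : ∀ x, f x = 0 := by simpa using hf0
    simp [this, ht]
  by_cases hg0 : ⨆ x, g x = 0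
  · have : ∀ x, g x = 0 := by simpa using hg0
    simp [this, h1t]
  set a := ⨆ x, f x
  set b := ⨆ x, g x
  set c := a ^ t * b ^ (1 - t) with hc
  have hc0 : c ≠ 0 := by simp [hc, hf0, hg0, ht.not_gt, h1t.not_gt]
  have hct : c ≠ ⊤ := ENNReal.mul_ne_top (ENNReal.rpow_ne_top_of_nonneg ht.le hf1)
    (ENNReal.rpow_ne_top_of_nonneg h1t.le hg1)
  have hcinv : c⁻¹ = (a⁻¹) ^ t * (b⁻¹) ^ (1 - t) := by
    rw [hc, ENNReal.mul_inv, ENNReal.inv_rpow, ENNReal.inv_rpow]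
    · left; simp [hf0, ht.not_gt]
    · left; exact ENNReal.rpow_ne_top_of_nonneg ht.le hf1
  have key := prekopaLeindler_real_of_iSup_eq_one (hf.mul_const a⁻¹) (hg.mul_const b⁻¹)
    (hh.mul_const c⁻¹) ht ht1 (by rw [← ENNReal.iSup_mul, ENNReal.mul_inv_cancel hf0 hf1])
    (by rw [← ENNReal.iSup_mul, ENNReal.mul_inv_cancel hg0 hg1]) (fun x y => by
      rw [ENNReal.mul_rpow_of_nonneg _ _ ht.le, ENNReal.mul_rpow_of_nonneg _ _ h1t.le, hcinv,
        mul_mul_mul_comm]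
      gcongr
      exact H x y)
  have key2 := (ennreal_rpow_mul_rpow_le ht ht1 _ _).trans key
  rw [lintegral_mul_const _ hf, lintegral_mul_const _ hg, lintegral_mul_const _ hh,
    ENNReal.mul_rpow_of_nonneg _ _ ht.le, ENNReal.mul_rpow_of_nonneg _ _ h1t.le,
    mul_mul_mul_comm, ← hcinv] at key2
  exact (ENNReal.mul_le_mul_iff_left (ENNReal.inv_ne_zero.2 hct)
    (ENNReal.inv_ne_top.2 hc0)).1 key2

theorem iSup_min_natCast (a : ENNReal) : ⨆ k : ℕ, min a k = a := by
  refine le_antisymm (iSup_le fun k => min_le_left _ _) ?_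
  refine le_of_forall_lt fun b hb => ?_
  obtain ⟨k, hk⟩ := ENNReal.exists_nat_gt (ne_top_of_lt hb)
  exact lt_of_lt_of_le (lt_min hb hk) (le_iSup (fun k : ℕ => min a (k : ENNReal)) k)

theorem lintegral_eq_iSup_min {α : Type*} [MeasurableSpace α] {μ : Measure α} {f : α → ENNReal}
    (hf : Measurable f) : ∫⁻ x, f x ∂μ = ⨆ k : ℕ, ∫⁻ x, min (f x) k ∂μ := by
  rw [← lintegral_iSup (fun k => hf.min measurable_const)]
  · simp_rw [iSup_min_natCast]
  · intro i j hij x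
    exact min_le_min le_rfl (by exact_mod_cast hij)

/-- The Prékopa-Leindler inequality on the line. -/
theorem prekopaLeindler_real {f g h : ℝ → ENNReal} (hf : Measurable f)
    (hg : Measurable g) (hh : Measurable h) {t : ℝ} (ht : 0 < t) (ht1 : t < 1)
    (H : ∀ x y, f x ^ t * g y ^ (1 - t) ≤ h (t * x + (1 - t) * y)) :
    (∫⁻ x, f x) ^ t * (∫⁻ x, g x) ^ (1 - t) ≤ ∫⁻ x, h x := by
  have h1t : 0 < 1 - t := sub_pos.2 ht1
  rw [lintegral_eq_iSup_min hf, lintegral_eq_iSup_min hg]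
  have e1 := (ENNReal.orderIsoRpow t ht).map_iSup fun k : ℕ => ∫⁻ x, min (f x) k
  have e2 := (ENNReal.orderIsoRpow (1 - t) h1t).map_iSup fun k : ℕ => ∫⁻ x, min (g x) k
  simp only [ENNReal.orderIsoRpow_apply] at e1 e2
  rw [e1, e2, ENNReal.iSup_mul]
  refine iSup_le fun i => ?_
  rw [ENNReal.mul_iSup]
  refine iSup_le fun j => prekopaLeindler_real_of_bounded (hf.min measurable_const)
    (hg.min measurable_const) hh ht ht1 ?_ ?_ fun x y => ?_
  · exact ((iSup_le fun x => min_le_right _ _).trans_lt (ENNReal.natCast_lt_top i)).ne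
  · exact ((iSup_le fun x => min_le_right _ _).trans_lt (ENNReal.natCast_lt_top j)).ne
  · refine le_trans ?_ (H x y)
    gcongr <;> exact min_le_left _ _

theorem lintegral_fin_succ {m : ℕ} (i : Fin (m + 1)) {f : (Fin (m + 1) → ℝ) → ENNReal}
    (hf : Measurable f) :
    ∫⁻ x, f x = ∫⁻ s : ℝ, ∫⁻ v : Fin m → ℝ, f (i.insertNth (α := fun _ => ℝ) s v) := by
  have hmp := (volume_preserving_piFinSuccAbove (fun _ : Fin (m + 1) => ℝ) i).symm
  rw [← hmp.lintegral_comp hf, Measure.volume_eq_prod, lintegral_prod]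
  · rfl
  · exact (hf.comp (MeasurableEquiv.measurable _)).aemeasurable

theorem measurable_uncurry_insertNth {m : ℕ} (i : Fin (m + 1)) :
    Measurable fun z : ℝ × (Fin m → ℝ) => i.insertNth (α := fun _ => ℝ) z.1 z.2 :=
  (MeasurableEquiv.piFinSuccAbove (fun _ : Fin (m + 1) => ℝ) i).symm.measurable

theorem insertNth_convexCombo {m : ℕ} (i : Fin (m + 1)) (a b x y : ℝ) (v w : Fin m → ℝ) :
    i.insertNth (α := fun _ => ℝ) (a * x + b * y) (a • v + b • w) =
      a • i.insertNth (α := fun _ => ℝ) x v + b • i.insertNth (α := fun _ => ℝ) y w := by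
  ext j
  refine Fin.succAboveCases i ?_ (fun j => ?_) j <;> simp

/-- The Prékopa-Leindler inequality. -/
theorem prekopaLeindler {m : ℕ} {f g h : (Fin m → ℝ) → ENNReal} (hf : Measurable f)
    (hg : Measurable g) (hh : Measurable h) {t : ℝ} (ht : 0 < t) (ht1 : t < 1)
    (H : ∀ x y, f x ^ t * g y ^ (1 - t) ≤ h (t • x + (1 - t) • y)) :
    (∫⁻ x, f x) ^ t * (∫⁻ x, g x) ^ (1 - t) ≤ ∫⁻ x, h x := by
  induction m with
  | zero =>
    have hv : (volume : Measure (Fin 0 → ℝ)) univ = 1 := by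
      rw [volume_pi, Measure.pi_univ]; simp
    rw [lintegral_unique, lintegral_unique, lintegral_unique, hv, mul_one, mul_one, mul_one]
    have := H default default
    rw [Subsingleton.elim (t • (default : Fin 0 → ℝ) + (1 - t) • default) default] at this
    convert this
  | succ m ih =>
    have hins := measurable_uncurry_insertNth (m := m) 0
    rw [lintegral_fin_succ 0 hf, lintegral_fin_succ 0 hg, lintegral_fin_succ 0 hh]
    refine prekopaLeindler_real (hf.comp hins).lintegral_prod_right'
      (hg.comp hins).lintegral_prod_right' (hh.comp hins).lintegral_prod_right' ht ht1
      fun x y => ?_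
    refine ih ((hf.comp hins).comp measurable_prodMk_left)
      ((hg.comp hins).comp measurable_prodMk_left) ((hh.comp hins).comp measurable_prodMk_left)
      fun v w => ?_
    have := H (Fin.insertNth (α := fun _ => ℝ) 0 x v) (Fin.insertNth (α := fun _ => ℝ) 0 y w)
    rw [← insertNth_convexCombo] at this
    exact this

theorem volume_inter_le_of_gaps {D U : Set ℝ} {y b : ℝ} {k : ENNReal} (hD : IsClosed D)
    (hDyb : D ⊆ Icc y b) (hy : y ∈ D) (hb : b ∈ D) (hUD : volume (U ∩ D) = 0)
    (hgap : ∀ a ∈ D, ∀ c ∈ D, a < c → volume (U ∩ Ioo a c) ≤ k * volume (Ioo a c)) :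
    volume (U ∩ Icc y b) ≤ k * volume (Icc y b \ D) := by
  set G : Set (ℝ × ℝ) := {p | p.1 ∈ D ∧ p.2 ∈ D ∧ p.1 < p.2 ∧ Disjoint (Ioo p.1 p.2) D} with hG
  have hdisj : G.PairwiseDisjoint fun p => Ioo p.1 p.2 := by
    rintro ⟨a, c⟩ ⟨ha, hc, hac, h1⟩ ⟨a', c'⟩ ⟨ha', hc', hac', h2⟩ hne
    refine Set.disjoint_left.2 fun x hx hx' => hne ?_
    have h1' : ∀ w, a < w ∧ w < c → w ∉ D := fun w hw hw' => Set.disjoint_left.1 h1 hw hw'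
    have h2' : ∀ w, a' < w ∧ w < c' → w ∉ D := fun w hw hw' => Set.disjoint_left.1 h2 hw hw'
    simp only [mem_Ioo] at *
    have e1 : a = a' := by
      rcases lt_trichotomy a a' with h | h | h
      · exact (h1' a' ⟨h, by linarith⟩ ha').elim
      · exact h
      · exact (h2' a ⟨h, by linarith⟩ ha).elim
    have e2 : c = c' := by
      rcases lt_trichotomy c c' with h | h | h
      · exact (h2' c ⟨by linarith, h⟩ hc).elim
      · exact h
      · exact (h1' c' ⟨by linarith, h⟩ hc').elim
    rw [e1, e2]
  have hcount : G.Countable :=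
    hdisj.countable_of_isOpen (fun _ _ => isOpen_Ioo) fun p hp => nonempty_Ioo.2 hp.2.2.1
  have hcover : Icc y b \ D ⊆ ⋃ p ∈ G, Ioo p.1 p.2 := by
    rintro x ⟨hx, hxD⟩
    have hne1 : (D ∩ Iic x).Nonempty := ⟨y, hy, hx.1⟩
    have hbd1 : BddAbove (D ∩ Iic x) := ⟨x, fun w hw => hw.2⟩
    have hne2 : (D ∩ Ici x).Nonempty := ⟨b, hb, hx.2⟩
    have hbd2 : BddBelow (D ∩ Ici x) := ⟨x, fun w hw => hw.2⟩
    have h1 := (hD.inter isClosed_Iic).csSup_mem hne1 hbd1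
    have h2 := (hD.inter isClosed_Ici).csInf_mem hne2 hbd2
    have h1' : sSup (D ∩ Iic x) < x := lt_of_le_of_ne h1.2 fun h => hxD (h ▸ h1.1)
    have h2' : x < sInf (D ∩ Ici x) := lt_of_le_of_ne h2.2 fun h => hxD (h ▸ h2.1)
    refine mem_biUnion (x := (sSup (D ∩ Iic x), sInf (D ∩ Ici x)))
      ⟨h1.1, h2.1, h1'.trans h2', Set.disjoint_left.2 fun w hw hwD => ?_⟩ ⟨h1', h2'⟩
    rcases le_total w x with h | h
    · exact absurd (le_csSup hbd1 ⟨hwD, h⟩) (not_le.2 hw.1)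
    · exact absurd (csInf_le hbd2 ⟨hwD, h⟩) (not_le.2 hw.2)
  have hsub : (⋃ p ∈ G, Ioo p.1 p.2) ⊆ Icc y b \ D := by
    refine iUnion₂_subset fun p hp x hx => ⟨⟨?_, ?_⟩, fun h => ?_⟩
    · exact (hDyb hp.1).1.trans hx.1.le
    · exact hx.2.le.trans (hDyb hp.2.1).2
    · exact Set.disjoint_left.1 hp.2.2.2 hx h
  have := hcount.to_subtype
  calc volume (U ∩ Icc y b)
      ≤ volume ((U ∩ D) ∪ ⋃ p ∈ G, U ∩ Ioo p.1 p.2) := by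
        refine measure_mono fun x hx => ?_
        by_cases hxD : x ∈ D
        · exact Or.inl ⟨hx.1, hxD⟩
        · right
          obtain ⟨p, hp, hxp⟩ := mem_iUnion₂.1 (hcover ⟨hx.2, hxD⟩)
          exact mem_biUnion hp ⟨hx.1, hxp⟩
    _ ≤ volume (U ∩ D) + volume (⋃ p ∈ G, U ∩ Ioo p.1 p.2) := measure_union_le _ _
    _ ≤ 0 + ∑' p : G, volume (U ∩ Ioo p.1.1 p.1.2) := by
        rw [hUD]; gcongr; exact measure_biUnion_le _ hcount _
    _ ≤ 0 + ∑' p : G, k * volume (Ioo p.1.1 p.1.2) := by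
        gcongr with p
        exact hgap _ p.2.1 _ p.2.2.1 p.2.2.2.1
    _ = k * volume (⋃ p ∈ G, Ioo p.1 p.2) := by
        rw [zero_add, ENNReal.tsum_mul_left, measure_biUnion hcount hdisj
          fun _ _ => measurableSet_Ioo]
    _ ≤ k * volume (Icc y b \ D) := by gcongr

theorem volume_inter_Icc_le_of_isClosed {C U : Set ℝ} {δ : ℝ} (hδ : 0 ≤ δ) (hC : IsClosed C)
    (hUC : Disjoint U C)
    (hle : ∀ x ∈ C, ∀ y ≤ x, volume (U ∩ Icc y x) ≤ ENNReal.ofReal (δ * (x - y)))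
    {b y : ℝ} (hb : b ∈ C) (hyb : y ≤ b) :
    volume (U ∩ Icc y b) ≤ ENNReal.ofReal δ * volume (Iic b \ C ∩ Icc y b) := by
  have key := volume_inter_le_of_gaps (D := insert y (C ∩ Icc y b)) (U := U) (y := y) (b := b)
    (k := ENNReal.ofReal δ) (by rw [insert_eq]; exact isClosed_singleton.union (hC.inter isClosed_Icc))
    (insert_subset ⟨le_rfl, hyb⟩ inter_subset_right) (mem_insert _ _)
    (mem_insert_of_mem _ ⟨hb, hyb, le_rfl⟩) ?_ ?_
  · refine key.trans ?_
    gcongr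
    rintro x ⟨hx, hx'⟩
    exact ⟨⟨hx.2, fun h => hx' (mem_insert_of_mem _ ⟨h, hx⟩)⟩, hx⟩
  · refine measure_mono_null (t := {y}) ?_ (by simp)
    rintro x ⟨hxU, rfl | hx⟩
    · rfl
    · exact (Set.disjoint_left.1 hUC hxU hx.1).elim
  · rintro a ha c hc hac
    have hc' : c ∈ C := by
      rcases hc with rfl | hc
      · rcases ha with rfl | ha
        · exact (lt_irrefl _ hac).elim
        · exact (not_le.2 hac ha.2.1).elim
      · exact hc.1
    rw [Real.volume_Ioo, ← ENNReal.ofReal_mul hδ]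
    exact (measure_mono (inter_subset_inter_right _ Ioo_subset_Icc_self)).trans (hle c hc' a hac.le)

/-- If `M` is the largest excess of `|U ∩ [y, z]|` over `δ |[y, z]|` and `b` is a point all of
whose left segments meet `U` in proportion at most `δ`, then `U` is dominated on left
neighbourhoods of `z` by a block adjacent to `z` and a part of density `δ`. -/
theorem volume_inter_Icc_le_block {C U : Set ℝ} {δ M M' b z : ℝ} (hδ : 0 < δ) (hδ1 : δ < 1)
    (hC : IsClosed C) (hUC : Disjoint U C)
    (hle : ∀ x ∈ C, ∀ y ≤ x, volume (U ∩ Icc y x) ≤ ENNReal.ofReal (δ * (x - y)))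
    (hb : b ∈ C) (hbz : b ≤ z) (hM0 : 0 ≤ M) (hM'0 : 0 ≤ M')
    (hM : ∀ y ∈ Icc b z, volume (U ∩ Icc y z) ≤ ENNReal.ofReal (M + δ * (z - y)))
    (hM' : volume (U ∩ Icc b z) ≤ ENNReal.ofReal (δ * (z - b) - M'))
    (hu : b + (M + M') / δ ≤ z - M / (1 - δ)) {y : ℝ} (hy : y ≤ z) :
    volume (U ∩ Icc y z) ≤ volume (Icc (z - M / (1 - δ)) z ∩ Icc y z) + ENNReal.ofReal δ *
      (volume (Icc (b + (M + M') / δ) (z - M / (1 - δ)) ∩ Icc y z) +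
        volume (Iic b \ C ∩ Icc y z)) := by
  have h1δ : 0 < 1 - δ := sub_pos.2 hδ1
  set u := z - M / (1 - δ) with hu'
  set τ := (M + M') / δ with hτ
  have hMu : M = (1 - δ) * (z - u) := by rw [hu']; field_simp; ring
  have hMτ : M + M' = δ * τ := by rw [hτ]; field_simp
  have hτ0 : 0 ≤ τ := div_nonneg (add_nonneg hM0 hM'0) hδ.le
  have huz : u ≤ z := sub_le_self _ (div_nonneg hM0 h1δ.le)
  rcases le_total u y with h | h
  · refine le_trans ?_ le_self_add
    refine measure_mono fun x hx => ⟨⟨h.trans hx.2.1, hx.2.2⟩, hx.2⟩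
  have hQ : ENNReal.ofReal (z - u) ≤ volume (Icc u z ∩ Icc y z) := by
    rw [← Real.volume_Icc]
    exact measure_mono fun x hx => ⟨hx, h.trans hx.1, hx.2⟩
  rcases le_total (b + τ) y with h' | h'
  · have hS : ENNReal.ofReal (u - y) ≤ volume (Icc (b + τ) u ∩ Icc y z) := by
      rw [← Real.volume_Icc]
      exact measure_mono fun x hx => ⟨⟨h'.trans hx.1, hx.2⟩, hx.1, hx.2.trans huz⟩
    calc volume (U ∩ Icc y z) ≤ ENNReal.ofReal (M + δ * (z - y)) := hM y ⟨by linarith, hy⟩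
      _ = ENNReal.ofReal (z - u) + ENNReal.ofReal δ * (ENNReal.ofReal (u - y) + 0) := by
        rw [add_zero, ← ENNReal.ofReal_mul hδ.le, ← ENNReal.ofReal_add (by linarith)
          (mul_nonneg hδ.le (by linarith))]
        congr 1; rw [hMu]; ring
      _ ≤ _ := by gcongr; exact zero_le
  have hS : ENNReal.ofReal (u - (b + τ)) ≤ volume (Icc (b + τ) u ∩ Icc y z) := by
    rw [← Real.volume_Icc]
    exact measure_mono fun x hx => ⟨hx, h'.trans hx.1, hx.2.trans huz⟩
  have hfar : volume (U ∩ Icc b z) ≤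
      ENNReal.ofReal (z - u) + ENNReal.ofReal δ * ENNReal.ofReal (u - (b + τ)) := by
    refine hM'.trans (le_of_eq ?_)
    rw [← ENNReal.ofReal_mul hδ.le, ← ENNReal.ofReal_add (by linarith)
      (mul_nonneg hδ.le (by linarith))]
    congr 1
    linear_combination hMu - hMτ
  rcases le_total b y with h'' | h''
  · calc volume (U ∩ Icc y z) ≤ volume (U ∩ Icc b z) := by gcongr
      _ ≤ ENNReal.ofReal (z - u) + ENNReal.ofReal δ * (ENNReal.ofReal (u - (b + τ)) + 0) := by
        rw [add_zero]; exact hfar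
      _ ≤ _ := by gcongr; exact zero_le
  · calc volume (U ∩ Icc y z) ≤ volume (U ∩ Icc b z) + volume (U ∩ Icc y b) := by
          refine (measure_mono fun x hx => ?_).trans (measure_union_le _ _)
          rcases le_total b x with h | h
          · exact Or.inl ⟨hx.1, h, hx.2.2⟩
          · exact Or.inr ⟨hx.1, hx.2.1, h⟩
      _ ≤ ENNReal.ofReal (z - u) + ENNReal.ofReal δ * ENNReal.ofReal (u - (b + τ)) +
          ENNReal.ofReal δ * volume (Iic b \ C ∩ Icc y b) :=
        add_le_add hfar (volume_inter_Icc_le_of_isClosed hδ.le hC hUC hle hb h'')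
      _ ≤ _ := by
        rw [add_assoc, ← mul_add]
        gcongr

theorem excess_shift_le {δ M M' b z : ℝ} {U : Set ℝ} (hδ : 0 < δ) (hδ1 : δ < 1)
    (hM : ∀ c, (∀ y ∈ Icc b z, volume.real (U ∩ Icc y z) ≤ c + δ * (z - y)) → M ≤ c)
    (hM' : volume.real (U ∩ Icc b z) ≤ δ * (z - b) - M') :
    b + (M + M') / δ ≤ z - M / (1 - δ) := by
  have h1δ : 0 < 1 - δ := sub_pos.2 hδ1
  have key : M ≤ (1 - δ) * (δ * (z - b) - M') := by
    refine hM _ fun y hy => ?_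
    have h1 : volume.real (U ∩ Icc y z) ≤ z - y := by
      rw [← Real.volume_real_Icc_of_le hy.2]
      exact measureReal_mono inter_subset_right (by simp)
    have h2 : volume.real (U ∩ Icc y z) ≤ volume.real (U ∩ Icc b z) :=
      measureReal_mono (inter_subset_inter_right _ (Icc_subset_Icc_left hy.1))
        (measure_ne_top_of_subset inter_subset_right (by simp))
    have h3 := mul_le_mul_of_nonneg_left (h2.trans hM') h1δ.le
    have h4 := mul_le_mul_of_nonneg_left h1 hδ.le
    linarith
  have h5 : M / (1 - δ) ≤ δ * (z - b) - M' := by rw [div_le_iff₀ h1δ]; linarith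
  have h6 : (M + M') / δ = M / δ + M' / δ := add_div _ _ _
  have h7 : M = (1 - δ) * (M / (1 - δ)) := by field_simp
  have : (M + M') / δ ≤ (z - b) - M / (1 - δ) := by
    rw [div_le_iff₀ hδ]
    linarith
  linarith

theorem withDensity_apply_eq_lintegral_measure_lt {α : Type*} [MeasurableSpace α] {μ : Measure α}
    {m : α → ENNReal} (hm : Measurable m) (hfin : ∀ᵐ x ∂μ, m x ≠ ⊤) {S : Set α}
    (hS : MeasurableSet S) :
    μ.withDensity m S = ∫⁻ s in Ioi (0 : ℝ), μ ({x | ENNReal.ofReal s < m x} ∩ S) := by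
  rw [withDensity_apply _ hS,
    lintegral_eq_lintegral_measure_lt _ hm (ae_restrict_of_ae hfin)]
  refine lintegral_congr fun s => ?_
  rw [Measure.restrict_apply (measurableSet_lt measurable_const hm)]

theorem volume_inter_Icc_le_of_ordConnected {L : Set ℝ} {a z : ℝ} (hL : L.OrdConnected)
    (ha : IsGLB L a) (hz : z ∈ closure L) (X : Set ℝ) :
    volume (X ∩ Icc a z) ≤ volume (L ∩ X) := by
  have h : X ∩ Icc a z ⊆ (L ∩ X) ∪ {a, z} := by
    rintro x ⟨hx, hax, hxz⟩
    rcases hax.eq_or_lt with rfl | hax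
    · right; simp
    rcases hxz.eq_or_lt with rfl | hxz
    · right; simp
    left
    refine ⟨?_, hx⟩
    obtain ⟨c, hc, hcx⟩ := (isGLB_lt_iff ha).1 hax
    obtain ⟨d, hd, hdL⟩ := mem_closure_iff.1 hz (Ioi x) isOpen_Ioi hxz
    exact hL.out hc hdL ⟨hcx.le, le_of_lt hd⟩
  calc volume (X ∩ Icc a z) ≤ volume (L ∩ X) + volume ({a, z} : Set ℝ) :=
        (measure_mono h).trans (measure_union_le _ _)
    _ = volume (L ∩ X) := by
        rw [(Set.toFinite {a, z}).measure_zero, add_zero]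

/-- Integrating an estimate on left neighbourhoods of `z` against a density all of whose
superlevel sets are intervals touching `z`. -/
theorem withDensity_inter_Iic_le {m : ℝ → ENNReal} (hm : Measurable m)
    (hfin : ∀ᵐ x, m x ≠ ⊤) {z : ℝ} {k : ENNReal}
    (hord : ∀ s : ℝ, {x | ENNReal.ofReal s < m x}.OrdConnected)
    (hbdd : ∀ s : ℝ, 0 < s → BddBelow {x | ENNReal.ofReal s < m x})
    (hz : ∀ s : ℝ, 0 < s → {x | ENNReal.ofReal s < m x}.Nonempty →
      z ∈ closure {x | ENNReal.ofReal s < m x})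
    {U P Q R : Set ℝ} (hU : MeasurableSet U) (hP : MeasurableSet P) (hQ : MeasurableSet Q)
    (hR : MeasurableSet R)
    (h : ∀ y ≤ z, volume (U ∩ Icc y z) ≤
      volume (P ∩ Icc y z) + k * (volume (Q ∩ Icc y z) + volume (R ∩ Icc y z))) :
    volume.withDensity m (U ∩ Iic z) ≤ volume.withDensity m P +
      k * (volume.withDensity m Q + volume.withDensity m R) := by
  have meas : ∀ {S : Set ℝ}, MeasurableSet S →
      Measurable fun s : ℝ => volume ({x | ENNReal.ofReal s < m x} ∩ S) := by
    intro S hS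
    have := measurable_measure_lt (volume.restrict S) m
    simpa only [Measure.restrict_apply (measurableSet_lt measurable_const hm)] using this
  have hk := lintegral_const_mul k (μ := volume.restrict (Ioi 0)) ((meas hQ).add (meas hR))
  simp only [Pi.add_apply] at hk
  rw [withDensity_apply_eq_lintegral_measure_lt hm hfin (hU.inter measurableSet_Iic),
    withDensity_apply_eq_lintegral_measure_lt hm hfin hP,
    withDensity_apply_eq_lintegral_measure_lt hm hfin hQ,
    withDensity_apply_eq_lintegral_measure_lt hm hfin hR,
    ← lintegral_add_left (meas hQ), ← hk, ← lintegral_add_left (meas hP)]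
  refine lintegral_mono_ae ((ae_restrict_iff' measurableSet_Ioi).2 (ae_of_all _ fun s hs => ?_))
  rcases eq_empty_or_nonempty {x | ENNReal.ofReal s < m x} with hL | hL
  · rw [hL]; simp
  have hzL := hz s hs hL
  set L := {x | ENNReal.ofReal s < m x} with hLdef
  have hglb : IsGLB L (sInf L) := isGLB_csInf hL (hbdd s hs)
  have hlez : sInf L ≤ z := by
    have : closure L ⊆ Ici (sInf L) := closure_minimal (fun x hx => hglb.1 hx) isClosed_Ici
    exact this hzL
  have key := fun X => volume_inter_Icc_le_of_ordConnected (hord s) hglb hzL X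
  calc volume (L ∩ (U ∩ Iic z)) ≤ volume (U ∩ Icc (sInf L) z) :=
        measure_mono fun x hx => ⟨hx.2.1, hglb.1 hx.1, hx.2.2⟩
    _ ≤ _ := h _ hlez
    _ ≤ _ := add_le_add (key P) (mul_le_mul' le_rfl (add_le_add (key Q) (key R)))

theorem ordConnected_lt_of_logConcave {m : ℝ → ENNReal}
    (hlc : ∀ x y t : ℝ, 0 < t → t < 1 → m x ^ t * m y ^ (1 - t) ≤ m (t * x + (1 - t) * y))
    (a : ENNReal) : {x | a < m x}.OrdConnected := by
  refine ordConnected_iff.2 fun x hx y hy hxy w hw => ?_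
  rcases hw.1.eq_or_lt with rfl | h1
  · exact hx
  rcases hw.2.eq_or_lt with rfl | h2
  · exact hy
  have hd : 0 < y - x := by linarith
  have ht : 0 < (y - w) / (y - x) := div_pos (by linarith) hd
  have ht1 : (y - w) / (y - x) < 1 := by rw [div_lt_one hd]; linarith
  have := hlc x y _ ht ht1
  rw [show (y - w) / (y - x) * x + (1 - (y - w) / (y - x)) * y = w by field_simp; ring] at this
  refine lt_of_lt_of_le ?_ this
  set t := (y - w) / (y - x)
  have hat : a = a ^ t * a ^ (1 - t) := by
    rw [← ENNReal.rpow_add_of_nonneg _ _ ht.le (by linarith)]; simp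
  rw [hat]
  exact ENNReal.mul_lt_mul (ENNReal.rpow_lt_rpow hx ht) (ENNReal.rpow_lt_rpow hy (by linarith))

/-- A point touching all superlevel sets of a compactly supported quasi-concave function. -/
theorem exists_mem_closure_lt {m : ℝ → ENNReal} {α β : ℝ} (hαβ : α ≤ β)
    (hsupp : ∀ x, x ∉ Icc α β → m x = 0) :
    ∃ z ∈ Icc α β, ∀ s : ℝ, 0 < s → {x | ENNReal.ofReal s < m x}.Nonempty →
      z ∈ closure {x | ENNReal.ofReal s < m x} := by
  have hsub : ∀ s : ℝ, {x | ENNReal.ofReal s < m x} ⊆ Icc α β := fun s x hx => by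
    by_contra h
    have hx' : ENNReal.ofReal s < m x := hx
    rw [hsupp x h] at hx'
    exact not_lt_zero hx'
  let ι := {s : ℝ // 0 < s ∧ {x | ENNReal.ofReal s < m x}.Nonempty}
  by_cases hι : Nonempty ι
  · have hdir : Directed (· ⊇ ·) fun i : ι => closure {x | ENNReal.ofReal i.1 < m x} := by
      intro i j
      rcases le_total i.1 j.1 with h | h
      · exact ⟨j, closure_mono fun x hx => lt_of_le_of_lt (ENNReal.ofReal_le_ofReal h) hx,
          subset_rfl⟩
      · exact ⟨i, subset_rfl,
          closure_mono fun x hx => lt_of_le_of_lt (ENNReal.ofReal_le_ofReal h) hx⟩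
    obtain ⟨z, hz⟩ := IsCompact.nonempty_iInter_of_directed_nonempty_isCompact_isClosed
      (fun i : ι => closure {x | ENNReal.ofReal i.1 < m x}) hdir (fun i => i.2.2.closure)
      (fun i => isCompact_Icc.of_isClosed_subset isClosed_closure
        (closure_minimal (hsub _) isClosed_Icc)) (fun i => isClosed_closure)
    rw [mem_iInter] at hz
    obtain ⟨i⟩ := hι
    exact ⟨z, closure_minimal (hsub _) isClosed_Icc (hz i), fun s hs hne => hz ⟨s, hs, hne⟩⟩
  · exact ⟨α, left_mem_Icc.2 hαβ, fun s hs hne => (hι ⟨⟨s, hs, hne⟩⟩).elim⟩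

theorem measure_Iic_logConcave {m : ℝ → ENNReal} (hm : Measurable m)
    (hlc : ∀ x y t : ℝ, 0 < t → t < 1 → m x ^ t * m y ^ (1 - t) ≤ m (t * x + (1 - t) * y))
    {x y t : ℝ} (ht : 0 < t) (ht1 : t < 1) :
    volume.withDensity m (Iic x) ^ t * volume.withDensity m (Iic y) ^ (1 - t) ≤
      volume.withDensity m (Iic (t * x + (1 - t) * y)) := by
  simp only [withDensity_apply _ measurableSet_Iic, ← lintegral_indicator measurableSet_Iic]
  refine prekopaLeindler_real (hm.indicator measurableSet_Iic) (hm.indicator measurableSet_Iic)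
    (hm.indicator measurableSet_Iic) ht ht1 fun a b => ?_
  have ht' : 0 < 1 - t := by linarith
  by_cases ha : a ∈ Iic x
  · by_cases hb : b ∈ Iic y
    · have hab : t * a + (1 - t) * b ∈ Iic (t * x + (1 - t) * y) :=
        add_le_add (mul_le_mul_of_nonneg_left ha ht.le) (mul_le_mul_of_nonneg_left hb ht'.le)
      rw [indicator_of_mem ha, indicator_of_mem hb, indicator_of_mem hab]
      exact hlc a b t ht ht1
    · rw [indicator_of_notMem hb, ENNReal.zero_rpow_of_pos ht', mul_zero]
      exact zero_le
  · rw [indicator_of_notMem ha, ENNReal.zero_rpow_of_pos ht, zero_mul]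
    exact zero_le

theorem logConcave_shift_le {Φ : ℝ → ENNReal} {lam b u ℓ : ℝ} (hlam : 1 < lam)
    (hΦ : ∀ x y t : ℝ, 0 < t → t < 1 → Φ x ^ t * Φ y ^ (1 - t) ≤ Φ (t * x + (1 - t) * y))
    (hℓ : 0 ≤ ℓ) (hbu : b + (lam - 1) * ℓ ≤ u) :
    Φ b * Φ (u + ℓ) ^ (lam - 1) ≤ Φ (b + (lam - 1) * ℓ) * Φ u ^ (lam - 1) := by
  rcases hℓ.eq_or_lt with rfl | hℓ
  · simp
  have hl : 0 < lam - 1 := by linarith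
  set τ := (lam - 1) * ℓ with hτ
  set D := u + ℓ - b with hD
  have hτ0 : 0 < τ := mul_pos hl hℓ
  have hDpos : 0 < D := by linarith
  have h1 := hΦ b (u + ℓ) (1 - τ / D) (by rw [sub_pos, div_lt_one hDpos]; linarith)
    (by have := div_pos hτ0 hDpos; linarith)
  have h2 := hΦ b (u + ℓ) (ℓ / D) (div_pos hℓ hDpos) (by rw [div_lt_one hDpos]; linarith)
  rw [show (1 - τ / D) * b + (1 - (1 - τ / D)) * (u + ℓ) = b + τ by
    have : τ / D * D = τ := by field_simp
    rw [hD] at this ⊢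
    linear_combination this, show 1 - (1 - τ / D) = τ / D by ring] at h1
  rw [show ℓ / D * b + (1 - ℓ / D) * (u + ℓ) = u by
    have : ℓ / D * D = ℓ := by field_simp
    rw [hD] at this ⊢
    linear_combination -this] at h2
  have h3 := ENNReal.rpow_le_rpow h2 hl.le
  refine le_trans (le_of_eq ?_) (mul_le_mul' h1 h3)
  have hs1 : ℓ / D < 1 := by rw [div_lt_one hDpos]; linarith
  have ht1 : τ / D < 1 := by rw [div_lt_one hDpos]; linarith
  rw [ENNReal.mul_rpow_of_nonneg _ _ hl.le, ← ENNReal.rpow_mul, ← ENNReal.rpow_mul,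
    mul_mul_mul_comm, ← ENNReal.rpow_add_of_nonneg _ _ (by linarith) (by positivity),
    ← ENNReal.rpow_add_of_nonneg _ _ (by positivity)
      (mul_nonneg (by linarith) hl.le)]
  congr 1
  · rw [show 1 - τ / D + ℓ / D * (lam - 1) = 1 by rw [hτ]; ring, ENNReal.rpow_one]
  · congr 1; rw [hτ]; ring

theorem volume_inter_Icc_le_ofReal {X : Set ℝ} {a b c : ℝ}
    (h : volume.real (X ∩ Icc a b) ≤ c) : volume (X ∩ Icc a b) ≤ ENNReal.ofReal c := by
  rw [← ofReal_measureReal (measure_ne_top_of_subset inter_subset_right (by simp))]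
  exact ENNReal.ofReal_le_ofReal h

/-- The one-sided estimates on the left of the mode `z`. -/
theorem left_estimates {m : ℝ → ENNReal} (hm : Measurable m)
    (hlc : ∀ x y t : ℝ, 0 < t → t < 1 → m x ^ t * m y ^ (1 - t) ≤ m (t * x + (1 - t) * y))
    (hN : ∫⁻ x, m x ≠ ⊤) {α β z lam : ℝ} (hlam : 1 < lam)
    (hsupp : ∀ x, x ∉ Icc α β → m x = 0)
    (hz : ∀ s : ℝ, 0 < s → {x | ENNReal.ofReal s < m x}.Nonempty →
      z ∈ closure {x | ENNReal.ofReal s < m x})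
    {U C : Set ℝ} (hU : IsOpen U) (hC : IsClosed C) (hUC : Disjoint U C)
    (hle : ∀ x ∈ C, ∀ y ≤ x, volume.real (U ∩ Icc y x) ≤ lam⁻¹ * (x - y))
    {b M M' : ℝ} (hb : b ∈ C) (hbz : b ≤ z) (hM0 : 0 ≤ M) (hM'0 : 0 ≤ M')
    (hM : ∀ y ∈ Icc b z, volume.real (U ∩ Icc y z) ≤ M + lam⁻¹ * (z - y))
    (hMle : ∀ c, (∀ y ∈ Icc b z, volume.real (U ∩ Icc y z) ≤ c + lam⁻¹ * (z - y)) → M ≤ c)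
    (hM' : volume.real (U ∩ Icc b z) ≤ lam⁻¹ * (z - b) - M') :
    b + (M + M') / lam⁻¹ ≤ z - M / (1 - lam⁻¹) ∧
    (volume.withDensity m).real (U ∩ Iic z) +
        (volume.withDensity m).real (Iic (z - M / (1 - lam⁻¹))) ≤
      (volume.withDensity m).real (Iic z) + lam⁻¹ *
        ((volume.withDensity m).real (Iic (z - M / (1 - lam⁻¹))) -
          (volume.withDensity m).real (Iic (b + (M + M') / lam⁻¹)) +
          (volume.withDensity m).real (Iic b \ C)) ∧
    (volume.withDensity m).real (Iic b) *
        (volume.withDensity m).real (Iic (z + M' / (1 - lam⁻¹))) ^ (lam - 1) ≤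
      (volume.withDensity m).real (Iic (b + (M + M') / lam⁻¹)) *
        (volume.withDensity m).real (Iic (z - M / (1 - lam⁻¹))) ^ (lam - 1) := by
  have hδ : 0 < lam⁻¹ := by positivity
  have hδ1 : lam⁻¹ < 1 := inv_lt_one_of_one_lt₀ hlam
  have h1δ : 0 < 1 - lam⁻¹ := by linarith
  have hfin : ∀ᵐ x, m x ≠ ⊤ := (ae_lt_top hm hN).mono fun x hx => hx.ne
  have hbu := excess_shift_le hδ hδ1 hMle hM'
  have hblock := fun y (hy : y ≤ z) => volume_inter_Icc_le_block hδ hδ1 hC hUC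
    (fun x hx y hy => volume_inter_Icc_le_ofReal (hle x hx y hy)) hb hbz hM0 hM'0
    (fun y hy => volume_inter_Icc_le_ofReal (hM y hy)) (volume_inter_Icc_le_ofReal hM') hbu hy
  have hbdd : ∀ s : ℝ, BddBelow {x | ENNReal.ofReal s < m x} := fun s => by
    refine ⟨α, fun x hx => ?_⟩
    by_contra h
    have hx' : ENNReal.ofReal s < m x := hx
    rw [hsupp x fun h' => h h'.1] at hx'
    exact not_lt_zero hx'
  have hmass := withDensity_inter_Iic_le hm hfin (fun s => ordConnected_lt_of_logConcave hlc _)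
    (fun s _ => hbdd s) hz hU.measurableSet measurableSet_Icc measurableSet_Icc
    (measurableSet_Iic.diff hC.measurableSet) hblock
  have hshift := logConcave_shift_le (Φ := fun x => volume.withDensity m (Iic x)) (b := b)
    (u := z - M / (1 - lam⁻¹)) (ℓ := (M + M') / (1 - lam⁻¹)) hlam
    (fun x y t ht ht1 => measure_Iic_logConcave hm hlc ht ht1)
    (div_nonneg (add_nonneg hM0 hM'0) h1δ.le)
  have hτ : (lam - 1) * ((M + M') / (1 - lam⁻¹)) = (M + M') / lam⁻¹ := by
    have : lam - 1 ≠ 0 := by linarith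
    have : lam ≠ 0 := by linarith
    field_simp
  have hv : z - M / (1 - lam⁻¹) + (M + M') / (1 - lam⁻¹) = z + M' / (1 - lam⁻¹) := by
    rw [add_div]; ring
  rw [hτ, hv] at hshift
  have hshift := hshift hbu
  set u := z - M / (1 - lam⁻¹) with hu
  set c := b + (M + M') / lam⁻¹ with hc
  set v := z + M' / (1 - lam⁻¹) with hv'
  have huz : u ≤ z := sub_le_self _ (div_nonneg hM0 h1δ.le)
  have : IsFiniteMeasure (volume.withDensity m) := isFiniteMeasure_withDensity hN
  set ν := volume.withDensity m with hν
  have hnull : ∀ x, ν {x} = 0 := fun x => withDensity_absolutelyContinuous _ _ (by simp)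
  have hIcc : ∀ a b, a ≤ b → ν.real (Icc a b) = ν.real (Iic b) - ν.real (Iic a) := by
    intro a b hab
    have h1 : ν.real (Icc a b) = ν.real (Ioc a b) := by
      refine measureReal_congr (?_ : Icc a b =ᵐ[ν] Ioc a b)
      exact (Ioc_ae_eq_Icc' (hnull a)).symm
    rw [h1, ← Iic_sdiff_Iic, measureReal_sdiff (Iic_subset_Iic.2 hab) measurableSet_Iic]
  refine ⟨hbu, ?_, ?_⟩
  · have h2 := ENNReal.toReal_mono (by finiteness) hmass
    rw [ENNReal.toReal_add (by finiteness) (by finiteness), ENNReal.toReal_mul,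
      ENNReal.toReal_add (by finiteness) (by finiteness), ENNReal.toReal_ofReal hδ.le] at h2
    change ν.real _ ≤ ν.real _ + lam⁻¹ * (ν.real _ + ν.real _) at h2
    rw [hIcc _ _ huz, hIcc _ _ hbu] at h2
    linarith
  · have h2 := ENNReal.toReal_mono
      (ENNReal.mul_ne_top (by finiteness) (ENNReal.rpow_ne_top_of_nonneg (by linarith)
        (by finiteness))) hshift
    simp only [ENNReal.toReal_mul, ← ENNReal.toReal_rpow] at h2
    exact h2

theorem withDensity_comp_neg {m : ℝ → ENNReal} (hm : Measurable m) {S : Set ℝ}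
    (hS : MeasurableSet S) :
    volume.withDensity (fun x => m (-x)) S = volume.withDensity m (Neg.neg ⁻¹' S) := by
  have hS' : MeasurableSet (Neg.neg ⁻¹' S) := measurable_neg hS
  rw [withDensity_apply _ hS, withDensity_apply _ hS',
    ← (Measure.measurePreserving_neg (volume : Measure ℝ)).setLIntegral_comp_preimage hS' hm]
  congr 2
  ext x; simp

theorem volume_real_neg_inter_Icc (U : Set ℝ) (a b : ℝ) :
    volume.real (Neg.neg ⁻¹' U ∩ Icc a b) = volume.real (U ∩ Icc (-b) (-a)) := by
  have h : Neg.neg ⁻¹' U ∩ Icc a b = Neg.neg ⁻¹' (U ∩ Icc (-b) (-a)) := by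
    ext x
    simp only [mem_inter_iff, mem_preimage, mem_Icc, neg_le_neg_iff]
    tauto
  have h1 : MeasurePreserving (MeasurableEquiv.neg ℝ) volume volume :=
    Measure.measurePreserving_neg (volume : Measure ℝ)
  rw [h, Measure.real, Measure.real]
  exact congrArg _ (h1.measure_preimage_equiv _)

theorem volume_real_inter_Icc_add {U : Set ℝ} {a b c : ℝ} (hU : MeasurableSet U) (hab : a ≤ b)
    (hbc : b ≤ c) :
    volume.real (U ∩ Icc a b) + volume.real (U ∩ Icc b c) = volume.real (U ∩ Icc a c) := by
  rw [← Icc_union_Icc_eq_Icc hab hbc, inter_union_distrib_left]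
  refine (measureReal_union₀ (hU.inter measurableSet_Icc).nullMeasurableSet ?_
    (measure_ne_top_of_subset inter_subset_right (by simp))
    (measure_ne_top_of_subset inter_subset_right (by simp))).symm
  refine measure_mono_null (t := {b}) ?_ (by simp)
  rintro x ⟨⟨-, h1⟩, -, h2⟩
  exact le_antisymm h1.2 h2.1

/-- The one-sided estimates on the right of the mode `z`. -/
theorem right_estimates {m : ℝ → ENNReal} (hm : Measurable m)
    (hlc : ∀ x y t : ℝ, 0 < t → t < 1 → m x ^ t * m y ^ (1 - t) ≤ m (t * x + (1 - t) * y))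
    (hN : ∫⁻ x, m x ≠ ⊤) {α β z lam : ℝ} (hlam : 1 < lam)
    (hsupp : ∀ x, x ∉ Icc α β → m x = 0)
    (hz : ∀ s : ℝ, 0 < s → {x | ENNReal.ofReal s < m x}.Nonempty →
      z ∈ closure {x | ENNReal.ofReal s < m x})
    {U C : Set ℝ} (hU : IsOpen U) (hC : IsClosed C) (hUC : Disjoint U C)
    (hle : ∀ x ∈ C, ∀ y, x ≤ y → volume.real (U ∩ Icc x y) ≤ lam⁻¹ * (y - x))
    {b M M' : ℝ} (hb : b ∈ C) (hbz : z ≤ b) (hM0 : 0 ≤ M) (hM'0 : 0 ≤ M')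
    (hM : ∀ y ∈ Icc z b, volume.real (U ∩ Icc z y) ≤ M + lam⁻¹ * (y - z))
    (hMle : ∀ c, (∀ y ∈ Icc z b, volume.real (U ∩ Icc z y) ≤ c + lam⁻¹ * (y - z)) → M ≤ c)
    (hM' : volume.real (U ∩ Icc z b) ≤ lam⁻¹ * (b - z) - M') :
    z + M / (1 - lam⁻¹) ≤ b - (M + M') / lam⁻¹ ∧
    (volume.withDensity m).real (U ∩ Ici z) +
        (volume.withDensity m).real (Ici (z + M / (1 - lam⁻¹))) ≤
      (volume.withDensity m).real (Ici z) + lam⁻¹ *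
        ((volume.withDensity m).real (Ici (z + M / (1 - lam⁻¹))) -
          (volume.withDensity m).real (Ici (b - (M + M') / lam⁻¹)) +
          (volume.withDensity m).real (Ici b \ C)) ∧
    (volume.withDensity m).real (Ici b) *
        (volume.withDensity m).real (Ici (z - M' / (1 - lam⁻¹))) ^ (lam - 1) ≤
      (volume.withDensity m).real (Ici (b - (M + M') / lam⁻¹)) *
        (volume.withDensity m).real (Ici (z + M / (1 - lam⁻¹))) ^ (lam - 1) := by
  have hpre : ∀ s : ℝ, {x | ENNReal.ofReal s < m (-x)} = Neg.neg ⁻¹' {x | ENNReal.ofReal s < m x} :=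
    fun s => rfl
  have key := left_estimates (m := fun x => m (-x)) (α := -β) (β := -α) (z := -z) (b := -b)
    (U := Neg.neg ⁻¹' U) (C := Neg.neg ⁻¹' C) (M := M) (M' := M')
    (hm.comp measurable_neg) (fun x y t ht ht1 => ?_) ?_ hlam
    (fun x hx => hsupp _ fun h => hx ⟨by linarith [h.2], by linarith [h.1]⟩) ?_
    (hU.preimage continuous_neg) (hC.preimage continuous_neg) (hUC.preimage _) ?_
    (by simpa using hb) (by linarith) hM0 hM'0 ?_ ?_ ?_
  · have hmeas : ∀ S, MeasurableSet S → (volume.withDensity fun x => m (-x)).real S =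
        (volume.withDensity m).real (Neg.neg ⁻¹' S) := fun S hS => by
      rw [Measure.real, withDensity_comp_neg hm hS, Measure.real]
    have hIic : ∀ x, (volume.withDensity fun x => m (-x)).real (Iic x) =
        (volume.withDensity m).real (Ici (-x)) := fun x => by
      rw [hmeas _ measurableSet_Iic]; congr 1; ext w; exact neg_le (a := w) (b := x)
    have hUz : (volume.withDensity fun x => m (-x)).real (Neg.neg ⁻¹' U ∩ Iic (-z)) =
        (volume.withDensity m).real (U ∩ Ici z) := by
      rw [hmeas _ ((measurable_neg hU.measurableSet).inter measurableSet_Iic)]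
      congr 1; ext w; simp
    have hCb : (volume.withDensity fun x => m (-x)).real (Iic (-b) \ Neg.neg ⁻¹' C) =
        (volume.withDensity m).real (Ici b \ C) := by
      rw [hmeas _ (measurableSet_Iic.diff (measurable_neg hC.measurableSet))]
      congr 1; ext w; simp
    rw [hUz, hCb] at key
    simp only [hIic, neg_neg, neg_add, neg_sub] at key
    rw [show M / (1 - lam⁻¹) - -z = z + M / (1 - lam⁻¹) by ring,
      show b + -((M + M') / lam⁻¹) = b - (M + M') / lam⁻¹ by ring,
      show z + -(M' / (1 - lam⁻¹)) = z - M' / (1 - lam⁻¹) by ring] at key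
    exact ⟨by linarith [key.1], key.2⟩
  · have := hlc (-x) (-y) t ht ht1
    rwa [show t * -x + (1 - t) * -y = -(t * x + (1 - t) * y) by ring] at this
  · rwa [(Measure.measurePreserving_neg (volume : Measure ℝ)).lintegral_comp hm]
  · intro s hs hne
    rw [hpre] at hne ⊢
    have h1 := hz s hs (by obtain ⟨x, hx⟩ := hne; exact ⟨-x, hx⟩)
    have h2 := (Homeomorph.neg ℝ).preimage_closure {x | ENNReal.ofReal s < m x}
    change Neg.neg ⁻¹' _ = closure (Neg.neg ⁻¹' _) at h2
    rw [← h2, mem_preimage, neg_neg]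
    exact h1
  · intro x hx y hy
    rw [volume_real_neg_inter_Icc]
    have := hle (-x) hx (-y) (by linarith)
    linarith
  · intro y hy
    rw [volume_real_neg_inter_Icc, neg_neg]
    have := hM (-y) ⟨by linarith [hy.2], by linarith [hy.1]⟩
    linarith
  · intro c hc
    refine hMle c fun y hy => ?_
    have := hc (-y) ⟨by linarith [hy.2], by linarith [hy.1]⟩
    rw [volume_real_neg_inter_Icc, neg_neg, neg_neg] at this
    linarith
  · rw [volume_real_neg_inter_Icc, neg_neg, neg_neg]
    linarith

theorem core_arithmetic {lam c₁ c₂ A₁ A₂ E₁ E₂ g₁ g₂ N e c : ℝ} (hlam : 1 < lam)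
    (hc₁ : 0 ≤ c₁) (hc₂ : 0 ≤ c₂) (hg₁ : 0 ≤ g₁) (hg₂ : 0 ≤ g₂) (hgc₁ : g₁ ≤ c₁) (hgc₂ : g₂ ≤ c₂)
    (hcA₁ : c₁ ≤ A₁) (hcA₂ : c₂ ≤ A₂) (hAE₁ : A₁ ≤ E₁) (hAE₂ : A₂ ≤ E₂) (hEN : E₁ + E₂ ≤ N)
    (hc : c ≤ c₁ + c₂ - g₁ - g₂)
    (he : E₁ + E₂ - lam⁻¹ * (E₁ + E₂ - (A₁ + A₂) + (g₁ + g₂)) ≤ e)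
    (h₁ : c₁ * (N - E₂) ^ (lam - 1) ≤ A₁ * E₁ ^ (lam - 1))
    (h₂ : c₂ * (N - E₁) ^ (lam - 1) ≤ A₂ * E₂ ^ (lam - 1)) :
    c * N ^ (lam - 1) ≤ e ^ lam := by
  have hl : 0 < lam - 1 := by linarith
  have aux : ∀ c A E E' : ℝ, 0 ≤ c → c ≤ A → A ≤ E → 0 ≤ E' → E + E' ≤ N →
      c * (N - E') ^ (lam - 1) ≤ A * E ^ (lam - 1) →
      c * N ^ (lam - 1) ≤ A * (E + E') ^ (lam - 1) := by
    intro c A E E' h0 hcA hAE hE' hN h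
    rcases (h0.trans (hcA.trans hAE)).eq_or_lt with hE | hE
    · have hA : A = 0 := by linarith
      have hc : c = 0 := by linarith
      rw [hA, hc]; simp
    have hpow : 0 < E ^ (lam - 1) := Real.rpow_pos_of_pos hE _
    have h1 : (E * N) ^ (lam - 1) ≤ ((E + E') * (N - E')) ^ (lam - 1) :=
      Real.rpow_le_rpow (by nlinarith) (by nlinarith) hl.le
    rw [Real.mul_rpow hE.le (by linarith), Real.mul_rpow (by linarith) (by linarith)] at h1
    have h2 : 0 ≤ (E + E') ^ (lam - 1) := Real.rpow_nonneg (by linarith) _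
    refine le_of_mul_le_mul_left ?_ hpow
    calc E ^ (lam - 1) * (c * N ^ (lam - 1)) = c * (E ^ (lam - 1) * N ^ (lam - 1)) := by ring
      _ ≤ c * ((E + E') ^ (lam - 1) * (N - E') ^ (lam - 1)) := by gcongr
      _ = (E + E') ^ (lam - 1) * (c * (N - E') ^ (lam - 1)) := by ring
      _ ≤ (E + E') ^ (lam - 1) * (A * E ^ (lam - 1)) := by gcongr
      _ = _ := by ring
  have k₁ := aux c₁ A₁ E₁ E₂ hc₁ hcA₁ hAE₁ (by linarith) hEN h₁
  have k₂ := aux c₂ A₂ E₂ E₁ hc₂ hcA₂ hAE₂ (by linarith) (by linarith) h₂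
  rw [add_comm E₂ E₁] at k₂
  set E := E₁ + E₂ with hE
  have hE0 : 0 ≤ E := by linarith
  have hEpow : E ^ (lam - 1) ≤ N ^ (lam - 1) := Real.rpow_le_rpow hE0 hEN hl.le
  have hNpow : 0 ≤ N ^ (lam - 1) := Real.rpow_nonneg (by linarith) _
  set B := A₁ + A₂ - (g₁ + g₂) with hB
  have hB0 : 0 ≤ B := by linarith
  have h3 : c * N ^ (lam - 1) ≤ E ^ (lam - 1) * B := by
    have := mul_le_mul_of_nonneg_right hc hNpow
    have := mul_le_mul_of_nonneg_left hEpow (add_nonneg hg₁ hg₂)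
    rw [hB]
    linarith
  refine h3.trans ?_
  have hδ : 0 < lam⁻¹ := by positivity
  have hδ1 : lam⁻¹ < 1 := inv_lt_one_of_one_lt₀ hlam
  have h4 := Real.geom_mean_le_arith_mean2_weighted (by linarith : 0 ≤ 1 - lam⁻¹) hδ.le hE0 hB0
    (by ring)
  have h5 : E ^ (1 - lam⁻¹) * B ^ lam⁻¹ ≤ e := h4.trans (by rw [hB]; linarith)
  have h6 := Real.rpow_le_rpow (by positivity) h5 (by linarith : 0 ≤ lam)
  refine le_trans (le_of_eq ?_) h6
  have hl0 : lam ≠ 0 := by linarith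
  rw [Real.mul_rpow (by positivity) (by positivity), ← Real.rpow_mul hE0, ← Real.rpow_mul hB0,
    inv_mul_cancel₀ hl0, Real.rpow_one, sub_mul, inv_mul_cancel₀ hl0, one_mul]

theorem isClosed_setOf_volume_inter_uIcc_le {U : Set ℝ} (hU : IsOpen U) (δ : ℝ) :
    IsClosed {x | x ∉ U ∧ ∀ y, volume.real (U ∩ uIcc x y) ≤ δ * |x - y|} := by
  have hlip : ∀ y, Continuous fun x => volume.real (U ∩ uIcc x y) := by
    intro y
    refine (LipschitzWith.of_le_add (f := fun x => volume.real (U ∩ uIcc x y))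
      fun x x' => ?_).continuous
    have hsub : U ∩ uIcc x y ⊆ (U ∩ uIcc x' y) ∪ uIcc x x' := fun w hw => by
      rcases uIcc_subset_uIcc_union_uIcc (b := x') hw.2 with h | h
      · exact Or.inr h
      · exact Or.inl ⟨hw.1, h⟩
    have hfin : ∀ a b : ℝ, volume (uIcc a b) ≠ ⊤ := fun a b => isCompact_uIcc.measure_ne_top
    calc volume.real (U ∩ uIcc x y) ≤ volume.real ((U ∩ uIcc x' y) ∪ uIcc x x') :=
          measureReal_mono hsub (measure_union_ne_top
            (measure_ne_top_of_subset inter_subset_right (hfin _ _)) (hfin _ _))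
      _ ≤ volume.real (U ∩ uIcc x' y) + volume.real (uIcc x x') := measureReal_union_le _ _
      _ = _ := by
        congr 1
        rw [Measure.real, Real.volume_interval, ENNReal.toReal_ofReal (abs_nonneg _), Real.dist_eq,
          abs_sub_comm]
  have : {x | x ∉ U ∧ ∀ y, volume.real (U ∩ uIcc x y) ≤ δ * |x - y|} =
      Uᶜ ∩ ⋂ y, {x | volume.real (U ∩ uIcc x y) ≤ δ * |x - y|} := by
    ext x; simp
  rw [this]
  refine hU.isClosed_compl.inter (isClosed_iInter fun y => isClosed_le (hlip y) ?_)
  fun_prop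

/-- The one-dimensional core inequality for a log-concave density with compact support. -/
theorem core_real_le {m : ℝ → ENNReal} (hm : Measurable m)
    (hlc : ∀ x y t : ℝ, 0 < t → t < 1 → m x ^ t * m y ^ (1 - t) ≤ m (t * x + (1 - t) * y))
    (hN : ∫⁻ x, m x ≠ ⊤) {α β lam : ℝ} (hαβ : α ≤ β) (hlam : 1 < lam)
    (hsupp : ∀ x, x ∉ Icc α β → m x = 0) {U : Set ℝ} (hU : IsOpen U) (hUsub : U ⊆ Icc α β) :
    (volume.withDensity m).real
        {x | x ∉ U ∧ ∀ y, volume.real (U ∩ uIcc x y) ≤ lam⁻¹ * |x - y|} *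
      (volume.withDensity m).real univ ^ (lam - 1) ≤ (volume.withDensity m).real Uᶜ ^ lam := by
  have hδ : 0 < lam⁻¹ := by positivity
  have hδ1 : lam⁻¹ < 1 := inv_lt_one_of_one_lt₀ hlam
  have h1δ : 0 < 1 - lam⁻¹ := by linarith
  have hC := isClosed_setOf_volume_inter_uIcc_le hU lam⁻¹
  set C := {x | x ∉ U ∧ ∀ y, volume.real (U ∩ uIcc x y) ≤ lam⁻¹ * |x - y|} with hCdef
  have hUC : Disjoint U C := Set.disjoint_left.2 fun x hx hx' => hx'.1 hx
  have hfinI : ∀ a b : ℝ, volume (U ∩ Icc a b) ≠ ⊤ := fun a b =>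
    measure_ne_top_of_subset inter_subset_right (by simp)
  have hleL : ∀ x ∈ C, ∀ y ≤ x, volume.real (U ∩ Icc y x) ≤ lam⁻¹ * (x - y) := fun x hx y hy => by
    have := hx.2 y
    rwa [uIcc_of_ge hy, abs_of_nonneg (by linarith)] at this
  have hleR : ∀ x ∈ C, ∀ y, x ≤ y → volume.real (U ∩ Icc x y) ≤ lam⁻¹ * (y - x) :=
    fun x hx y hy => by
      have := hx.2 y
      rwa [uIcc_of_le hy, abs_sub_comm, abs_of_nonneg (by linarith)] at this
  have hvolU : ∀ a b : ℝ, volume.real (U ∩ uIcc a b) ≤ β - α := fun a b => by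
    rw [← Real.volume_real_Icc_of_le hαβ]
    exact measureReal_mono (inter_subset_left.trans hUsub) (by simp)
  obtain ⟨z, hzI, hz⟩ := exists_mem_closure_lt hαβ hsupp
  set R := lam * (β - α) + 1 with hR
  have hRpos : 0 < R := by have := mul_nonneg (by linarith : 0 ≤ lam) (sub_nonneg.2 hαβ); linarith
  have hfar : ∀ x, (∀ w ∈ Icc α β, R ≤ |w - x|) → x ∈ C := fun x hx => by
    refine ⟨fun h => ?_, fun y => ?_⟩
    · have := hx x (hUsub h)
      rw [sub_self, abs_zero] at this
      linarith
    rcases le_or_gt R |x - y| with hy | hy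
    · refine (hvolU _ _).trans ?_
      calc β - α = lam⁻¹ * (lam * (β - α)) := by field_simp
        _ ≤ _ := by gcongr; linarith
    · have : U ∩ uIcc x y = ∅ := by
        refine eq_empty_of_forall_notMem fun w hw => ?_
        have h1 := hx w (hUsub hw.1)
        have h2 := abs_sub_left_of_mem_uIcc hw.2
        rw [abs_sub_comm y x] at h2
        linarith
      rw [this, measureReal_empty]
      positivity
  have hfarL : α - R ∈ C := hfar _ fun w hw => by
    rw [abs_of_nonneg] <;> linarith [hw.1]
  have hfarR : β + R ∈ C := hfar _ fun w hw => by
    rw [abs_of_nonpos] <;> linarith [hw.2]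
  have hne1 : (C ∩ Iic z).Nonempty := ⟨_, hfarL, by simp only [mem_Iic]; linarith [hzI.1]⟩
  have hne2 : (C ∩ Ici z).Nonempty := ⟨_, hfarR, by simp only [mem_Ici]; linarith [hzI.2]⟩
  have hbd1 : BddAbove (C ∩ Iic z) := ⟨z, fun w hw => hw.2⟩
  have hbd2 : BddBelow (C ∩ Ici z) := ⟨z, fun w hw => hw.2⟩
  obtain ⟨hb₁C, hb₁z⟩ := (hC.inter isClosed_Iic).csSup_mem hne1 hbd1
  obtain ⟨hb₂C, hb₂z⟩ := (hC.inter isClosed_Ici).csInf_mem hne2 hbd2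
  have hCsub : C ⊆ (C ∩ Iic (sSup (C ∩ Iic z))) ∪ (C ∩ Ici (sInf (C ∩ Ici z))) := fun w hw => by
    rcases le_total w z with h | h
    · exact Or.inl ⟨hw, le_csSup hbd1 ⟨hw, h⟩⟩
    · exact Or.inr ⟨hw, csInf_le hbd2 ⟨hw, h⟩⟩
  set b₁ := sSup (C ∩ Iic z)
  set b₂ := sInf (C ∩ Ici z)
  simp only [mem_Iic, mem_Ici] at hb₁z hb₂z
  obtain ⟨M, hM⟩ : ∃ M, IsLUB
      ((fun y => volume.real (U ∩ Icc y z) - lam⁻¹ * (z - y)) '' Icc b₁ z) M :=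
    ⟨_, isLUB_csSup ⟨_, z, right_mem_Icc.2 hb₁z, rfl⟩ ⟨β - α, by
      rintro _ ⟨y, hy, rfl⟩
      have h1 := hvolU y z
      rw [uIcc_of_le hy.2] at h1
      have := mul_nonneg hδ.le (sub_nonneg.2 hy.2)
      simp only; linarith⟩⟩
  obtain ⟨M', hM'⟩ : ∃ M', IsLUB
      ((fun y => volume.real (U ∩ Icc z y) - lam⁻¹ * (y - z)) '' Icc z b₂) M' :=
    ⟨_, isLUB_csSup ⟨_, z, left_mem_Icc.2 hb₂z, rfl⟩ ⟨β - α, by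
      rintro _ ⟨y, hy, rfl⟩
      have h1 := hvolU z y
      rw [uIcc_of_le hy.1] at h1
      have := mul_nonneg hδ.le (sub_nonneg.2 hy.1)
      simp only; linarith⟩⟩
  have hself : volume.real (U ∩ Icc z z) = 0 := by
    rw [Measure.real, measure_mono_null inter_subset_right (by rw [Icc_self]; simp),
      ENNReal.toReal_zero]
  have hM0 : 0 ≤ M := by
    have := hM.1 ⟨z, right_mem_Icc.2 hb₁z, rfl⟩
    simp only [hself] at this
    linarith
  have hM'0 : 0 ≤ M' := by
    have := hM'.1 ⟨z, left_mem_Icc.2 hb₂z, rfl⟩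
    simp only [hself] at this
    linarith
  have hMM'₁ : volume.real (U ∩ Icc b₁ z) ≤ lam⁻¹ * (z - b₁) - M' := by
    have : M' ≤ lam⁻¹ * (z - b₁) - volume.real (U ∩ Icc b₁ z) := by
      refine hM'.2 ?_
      rintro _ ⟨y, hy, rfl⟩
      have h1 := hleR b₁ hb₁C y (hb₁z.trans hy.1)
      rw [← volume_real_inter_Icc_add hU.measurableSet hb₁z hy.1] at h1
      simp only; linarith
    linarith
  have hMM'₂ : volume.real (U ∩ Icc z b₂) ≤ lam⁻¹ * (b₂ - z) - M := by
    have : M ≤ lam⁻¹ * (b₂ - z) - volume.real (U ∩ Icc z b₂) := by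
      refine hM.2 ?_
      rintro _ ⟨y, hy, rfl⟩
      have h1 := hleL b₂ hb₂C y (hy.2.trans hb₂z)
      rw [← volume_real_inter_Icc_add hU.measurableSet hy.2 hb₂z] at h1
      simp only; linarith
    linarith
  obtain ⟨hL1, hL2, hL3⟩ := left_estimates hm hlc hN hlam hsupp hz hU hC hUC hleL hb₁C hb₁z hM0 hM'0
    (fun y hy => by have := hM.1 ⟨y, hy, rfl⟩; simp only at this; linarith)
    (fun c hc => hM.2 (by rintro _ ⟨y, hy, rfl⟩; have := hc y hy; simp only; linarith)) hMM'₁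
  obtain ⟨hR1, hR2, hR3⟩ := right_estimates hm hlc hN hlam hsupp hz hU hC hUC hleR hb₂C hb₂z hM'0 hM0
    (fun y hy => by have := hM'.1 ⟨y, hy, rfl⟩; simp only at this; linarith)
    (fun c hc => hM'.2 (by rintro _ ⟨y, hy, rfl⟩; have := hc y hy; simp only; linarith)) hMM'₂
  rw [add_comm M' M] at hR1 hR2 hR3
  have huz₁ : z - M / (1 - lam⁻¹) ≤ z := sub_le_self _ (div_nonneg hM0 h1δ.le)
  have huz₂ : z ≤ z + M' / (1 - lam⁻¹) := le_add_of_nonneg_right (div_nonneg hM'0 h1δ.le)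
  have hτ : 0 ≤ (M + M') / lam⁻¹ := div_nonneg (add_nonneg hM0 hM'0) hδ.le
  set u₁ := z - M / (1 - lam⁻¹)
  set u₂ := z + M' / (1 - lam⁻¹)
  set τ := (M + M') / lam⁻¹
  have : IsFiniteMeasure (volume.withDensity m) := isFiniteMeasure_withDensity hN
  set ν := volume.withDensity m with hν
  have hnull : ∀ x, ν {x} = 0 := fun x => withDensity_absolutelyContinuous _ _ (by simp)
  have hsplit : ∀ x, ν.real (Iic x) + ν.real (Ici x) = ν.real univ := fun x => by
    have h1 : ν.real (Ici x) = ν.real (Ioi x) :=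
      measureReal_congr (Ioi_ae_eq_Ici' (hnull x)).symm
    rw [h1, ← compl_Iic]
    exact measureReal_add_measureReal_compl measurableSet_Iic
  have hUsplit : ν.real U ≤ ν.real (U ∩ Iic z) + ν.real (U ∩ Ici z) := by
    refine (measureReal_mono fun w hw => ?_).trans (measureReal_union_le _ _)
    rcases le_total w z with h | h
    · exact Or.inl ⟨hw, h⟩
    · exact Or.inr ⟨hw, h⟩
  have hUcompl := measureReal_add_measureReal_compl (μ := ν) hU.measurableSet
  have hCν : ν.real C ≤ ν.real (Iic b₁) + ν.real (Ici b₂) - ν.real (Iic b₁ \ C)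
      - ν.real (Ici b₂ \ C) := by
    have h0 := (measureReal_mono (μ := ν) hCsub).trans (measureReal_union_le _ _)
    have h1 := measureReal_sdiff_add_inter (μ := ν) (s := Iic b₁) hC.measurableSet
    have h2 := measureReal_sdiff_add_inter (μ := ν) (s := Ici b₂) hC.measurableSet
    rw [inter_comm] at h1 h2
    linarith
  have hE₁ : ν.real univ - ν.real (Iic u₁) = ν.real (Ici u₁) := by linarith [hsplit u₁]
  have hE₂ : ν.real univ - ν.real (Ici u₂) = ν.real (Iic u₂) := by linarith [hsplit u₂]
  refine core_arithmetic (c₁ := ν.real (Iic b₁)) (c₂ := ν.real (Ici b₂))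
    (A₁ := ν.real (Iic (b₁ + τ))) (A₂ := ν.real (Ici (b₂ - τ)))
    (E₁ := ν.real (Iic u₁)) (E₂ := ν.real (Ici u₂))
    (g₁ := ν.real (Iic b₁ \ C)) (g₂ := ν.real (Ici b₂ \ C)) hlam
    measureReal_nonneg measureReal_nonneg measureReal_nonneg measureReal_nonneg
    (measureReal_mono sdiff_subset) (measureReal_mono sdiff_subset)
    (measureReal_mono (Iic_subset_Iic.2 (by linarith)))
    (measureReal_mono (Ici_subset_Ici.2 (by linarith)))
    (measureReal_mono (Iic_subset_Iic.2 hL1)) (measureReal_mono (Ici_subset_Ici.2 hR1))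
    ?_ hCν ?_ (by rw [hE₂]; exact hL3) (by rw [hE₁]; exact hR3)
  · have := measureReal_mono (μ := ν) (Iic_subset_Iic.2 (huz₁.trans huz₂))
    linarith [hsplit u₂]
  · have := hsplit z
    nlinarith

/-- Coordinate marginals of log-concave densities are log-concave. -/
theorem exists_marginal {k : ℕ} (i : Fin (k + 1))
    {g : EuclideanSpace ℝ (Fin (k + 1)) → ENNReal} (hg : Measurable g)
    (hlc : ∀ x y, ∀ t : ℝ, 0 < t → t < 1 → g x ^ t * g y ^ (1 - t) ≤ g (t • x + (1 - t) • y)) :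
    ∃ m : ℝ → ENNReal, Measurable m ∧
      (∀ x y t : ℝ, 0 < t → t < 1 → m x ^ t * m y ^ (1 - t) ≤ m (t * x + (1 - t) * y)) ∧
      (volume.withDensity g).map (fun x => x i) = volume.withDensity m ∧
      ∀ s, (∀ x, x i = s → g x = 0) → m s = 0 := by
  set f : (Fin (k + 1) → ℝ) → ENNReal := fun v => g (WithLp.toLp 2 v) with hf
  have htoLp : Measurable (WithLp.toLp 2 : (Fin (k + 1) → ℝ) → EuclideanSpace ℝ (Fin (k + 1))) :=
    (PiLp.volume_preserving_toLp (Fin (k + 1))).measurable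
  have hfm : Measurable f := hg.comp htoLp
  have hfi : Measurable fun q : ℝ × (Fin k → ℝ) => f (i.insertNth (α := fun _ => ℝ) q.1 q.2) :=
    hfm.comp (measurable_uncurry_insertNth i)
  have hflc : ∀ x y, ∀ t : ℝ, 0 < t → t < 1 →
      f x ^ t * f y ^ (1 - t) ≤ f (t • x + (1 - t) • y) := fun x y t ht ht1 =>
    hlc _ _ t ht ht1
  refine ⟨fun s => ∫⁻ v : Fin k → ℝ, f (i.insertNth (α := fun _ => ℝ) s v),
    hfi.lintegral_prod_right', fun x y t ht ht1 => ?_, ?_, fun s hs => ?_⟩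
  · refine prekopaLeindler (hfi.comp measurable_prodMk_left) (hfi.comp measurable_prodMk_left)
      (hfi.comp measurable_prodMk_left) ht ht1 fun v w => ?_
    have := hflc (i.insertNth (α := fun _ => ℝ) x v) (i.insertNth (α := fun _ => ℝ) y w) t ht ht1
    rw [← insertNth_convexCombo] at this
    exact this
  · have hπ : Measurable fun x : EuclideanSpace ℝ (Fin (k + 1)) => x i := by fun_prop
    ext S hS
    rw [Measure.map_apply hπ hS, withDensity_apply _ (hπ hS), withDensity_apply _ hS,
      ← lintegral_indicator (hπ hS), ← lintegral_indicator hS,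
      ← (PiLp.volume_preserving_toLp (Fin (k + 1))).lintegral_comp (hg.indicator (hπ hS)),
      lintegral_fin_succ i (f := fun v => indicator _ g (WithLp.toLp 2 v))
        ((hg.indicator (hπ hS)).comp htoLp)]
    refine lintegral_congr fun s => ?_
    by_cases hs : s ∈ S
    · rw [indicator_of_mem hs]
      refine lintegral_congr fun v => ?_
      exact indicator_of_mem (by simpa using hs) _
    · rw [indicator_of_notMem hs, lintegral_eq_zero_of_ae_eq_zero (ae_of_all _ fun v => ?_)]
      exact indicator_of_notMem (by simpa using hs) _
  · exact lintegral_eq_zero_of_ae_eq_zero (ae_of_all _ fun v => hs _ (by simp))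

theorem withDensity_indicator_eq_restrict {α : Type*} [MeasurableSpace α] (μ : Measure α)
    {K : Set α} (hK : MeasurableSet K) (g : α → ENNReal) :
    μ.withDensity (K.indicator g) = (μ.withDensity g).restrict K := by
  rw [withDensity_indicator hK, restrict_withDensity hK]

open scoped Pointwise in
theorem volume_image_affine (a d : ℝ) (A : Set ℝ) :
    volume ((fun t => a + t * d) '' A) = ENNReal.ofReal |d| * volume A := by
  have h : (fun t => a + t * d) '' A = a +ᵥ (d • A) := by
    ext x
    simp only [mem_image, mem_vadd_set, mem_smul_set, smul_eq_mul, vadd_eq_add]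
    constructor
    · rintro ⟨t, ht, rfl⟩
      exact ⟨d * t, ⟨t, ht, rfl⟩, by ring⟩
    · rintro ⟨_, ⟨t, ht, rfl⟩, rfl⟩
      exact ⟨t, ht, by ring⟩
  rw [h, measure_vadd, Measure.addHaar_smul]
  simp

/-- If the points of `E` occupy a proportion at least `1 - λ⁻¹` of the segment `[x, w]`, then the
complement of the projection of `E` occupies a proportion at most `λ⁻¹` of the projected segment. -/
theorem volume_inter_uIcc_le_of_mem_core {n : ℕ} {E F K : Set (EuclideanSpace ℝ (Fin n))}
    {lam : ℝ} (hlam : 1 < lam) (i : Fin n) (hE : IsClosed E) (hK : Convex ℝ K) (hKF : K ⊆ F)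
    {U : Set ℝ} (hU : Disjoint U ((fun x => x i) '' (E ∩ K)))
    {x w : EuclideanSpace ℝ (Fin n)} (hx : x ∈ core E F lam) (hxK : x ∈ K) (hw : w ∈ K) :
    volume.real (U ∩ uIcc (x i) (w i)) ≤ lam⁻¹ * |x i - w i| := by
  rcases eq_or_ne (x i) (w i) with hxw | hxw
  · rw [hxw, uIcc_self, sub_self, abs_zero, mul_zero, Measure.real,
      measure_mono_null inter_subset_right (by simp), ENNReal.toReal_zero]
  have hne : x ≠ w := fun h => hxw (by rw [h])
  have hdist : 0 < dist x w := dist_pos.2 hne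
  have hc := hx.2 x w (left_mem_segment ℝ x w) ((hK.segment_subset hxK hw).trans hKF)
  set T := {t : ℝ | t ∈ Icc (0 : ℝ) 1 ∧ x + t • (w - x) ∈ E} with hT
  have hTv : (lam - 1) / lam ≤ volume.real T := by
    rw [segmentMeasure, mul_comm] at hc
    exact le_of_mul_le_mul_left hc hdist
  have hTm : MeasurableSet T :=
    measurableSet_Icc.inter (hE.preimage (by fun_prop : Continuous fun t : ℝ => x + t • (w - x))).measurableSet
  set A := Icc (0 : ℝ) 1 \ T with hA
  have hAv : volume.real A ≤ lam⁻¹ := by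
    have h1 := measureReal_sdiff_add_inter (μ := volume) (s := Icc (0 : ℝ) 1) hTm (by simp)
    rw [inter_eq_self_of_subset_right (fun t ht => ht.1), Real.volume_real_Icc_of_le zero_le_one]
      at h1
    have h2 : (lam - 1) / lam = 1 - lam⁻¹ := by
      have : lam ≠ 0 := by linarith
      field_simp
    linarith
  have hsub : U ∩ uIcc (x i) (w i) ⊆ (fun t => x i + t * (w i - x i)) '' A := by
    rintro s ⟨hsU, hs⟩
    rw [← segment_eq_uIcc, segment_eq_image'] at hs
    obtain ⟨t, ht, rfl⟩ := hs
    refine ⟨t, ⟨ht, fun htT => ?_⟩, by simp⟩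
    refine Set.disjoint_left.1 hU hsU ⟨x + t • (w - x), ⟨htT.2, ?_⟩, by simp⟩
    exact hK.add_smul_sub_mem hxK hw ht
  have hfin : volume A ≠ ⊤ := measure_ne_top_of_subset sdiff_subset (by simp)
  calc volume.real (U ∩ uIcc (x i) (w i))
      ≤ volume.real ((fun t => x i + t * (w i - x i)) '' A) := by
        refine measureReal_mono hsub ?_
        rw [volume_image_affine]
        exact ENNReal.mul_ne_top (by simp) hfin
    _ = |x i - w i| * volume.real A := by
        rw [Measure.real, volume_image_affine, ENNReal.toReal_mul,
          ENNReal.toReal_ofReal (abs_nonneg _), abs_sub_comm, Measure.real]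
    _ ≤ _ := by rw [mul_comm]; gcongr

/-- The core inequality on a convex body that is thin in all directions transversal to the
`i`-th coordinate. -/
theorem core_real_le_of_thin {k : ℕ} (i : Fin (k + 1))
    {g : EuclideanSpace ℝ (Fin (k + 1)) → ENNReal} (hg : Measurable g)
    (hlc : ∀ x y, ∀ t : ℝ, 0 < t → t < 1 → g x ^ t * g y ^ (1 - t) ≤ g (t • x + (1 - t) • y))
    {ρ : Measure (EuclideanSpace ℝ (Fin (k + 1)))} (hρ : ρ = volume.withDensity g)
    [IsFiniteMeasure ρ] {E F K : Set (EuclideanSpace ℝ (Fin (k + 1)))} {lam ε : ℝ}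
    (hlam : 1 < lam) (hE : IsClosed E) (hKc : IsCompact K) (hK : Convex ℝ K) (hKF : K ⊆ F)
    (hKne : K.Nonempty)
    (hthin : ∀ x ∈ K, ∀ y ∈ K, x i = y i → dist x y ≤ ε) :
    ρ.real (core E F lam ∩ K) * ρ.real K ^ (lam - 1) ≤
      ρ.real (Metric.cthickening ε E ∩ K) ^ lam := by
  have hπ : Continuous fun x : EuclideanSpace ℝ (Fin (k + 1)) => x i := by fun_prop
  have hKm := hKc.isClosed.measurableSet
  obtain ⟨m, hm, hmlc, hmap, hm0⟩ := exists_marginal i (hg.indicator hKm) fun x y t ht ht1 => by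
    by_cases hx : x ∈ K
    · by_cases hy : y ∈ K
      · rw [indicator_of_mem hx, indicator_of_mem hy,
          indicator_of_mem (hK hx hy ht.le (by linarith) (by ring))]
        exact hlc x y t ht ht1
      · rw [indicator_of_notMem hy, ENNReal.zero_rpow_of_pos (by linarith), mul_zero]
        exact zero_le
    · rw [indicator_of_notMem hx, ENNReal.zero_rpow_of_pos ht, zero_mul]
      exact zero_le
  rw [withDensity_indicator_eq_restrict _ hKm, ← hρ] at hmap
  have hν : ∀ S : Set ℝ, MeasurableSet S →
      volume.withDensity m S = ρ ((fun x => x i) ⁻¹' S ∩ K) := fun S hS => by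
    rw [← hmap, Measure.map_apply hπ.measurable hS, Measure.restrict_apply (hπ.measurable hS)]
  have hνuniv : volume.withDensity m univ = ρ K := by
    rw [hν _ MeasurableSet.univ, preimage_univ, univ_inter]
  have hN : ∫⁻ x, m x ≠ ⊤ := by
    rw [← setLIntegral_univ, ← withDensity_apply _ MeasurableSet.univ, hνuniv]
    finiteness
  have : IsFiniteMeasure (volume.withDensity m) := isFiniteMeasure_withDensity hN
  obtain ⟨α, β, hαβ, hI⟩ : ∃ α β : ℝ, α ≤ β ∧ (fun x => x i) '' K = Icc α β := by
    have h1 := (hKc.image hπ).isClosed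
    have h2 : IsPreconnected ((fun x => x i) '' K) := hK.isPreconnected.image _ hπ.continuousOn
    have h3 := eq_Icc_of_connected_compact ⟨hKne.image _, h2⟩ (hKc.image hπ)
    refine ⟨_, _, ?_, h3⟩
    have := hKne.image (fun x => x i)
    rw [h3] at this
    exact nonempty_Icc.1 this
  have hKI : ∀ x ∈ K, x i ∈ Icc α β := fun x hx => hI ▸ mem_image_of_mem _ hx
  have hP : IsCompact ((fun x => x i) '' (E ∩ K)) := (hKc.inter_left hE).image hπ
  set P := (fun x : EuclideanSpace ℝ (Fin (k + 1)) => x i) '' (E ∩ K) with hPdef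
  have hU : IsOpen (Ioo α β \ P) := isOpen_Ioo.sdiff hP.isClosed
  have hUI : Ioo α β \ P ⊆ Icc α β := sdiff_subset.trans Ioo_subset_Icc_self
  have key := core_real_le hm hmlc hN hαβ hlam (fun s hs => hm0 s fun x hx =>
    indicator_of_notMem (fun hxK => hs (hx ▸ hKI x hxK)) _) hU hUI
  have hCcl := isClosed_setOf_volume_inter_uIcc_le hU lam⁻¹
  set U := Ioo α β \ P with hUdef
  set C := {x | x ∉ U ∧ ∀ y, volume.real (U ∩ uIcc x y) ≤ lam⁻¹ * |x - y|} with hC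
  have hUP : Disjoint U P := disjoint_sdiff_left
  have hcoreC : ∀ x ∈ core E F lam ∩ K, x i ∈ C := by
    rintro x ⟨hx, hxK⟩
    refine ⟨fun h => h.2 ⟨x, ⟨hx.1, hxK⟩, rfl⟩, fun y => ?_⟩
    have hxI := hKI x hxK
    have hy' : max α (min β y) ∈ Icc α β := ⟨le_max_left _ _, max_le hαβ (min_le_left _ _)⟩
    obtain ⟨w, hw, hwy⟩ := hI.symm ▸ hy'
    have h1 := volume_inter_uIcc_le_of_mem_core hlam i hE hK hKF hUP hx hxK hw
    simp only at hwy
    rw [hwy] at h1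
    have h2 : U ∩ uIcc (x i) y ⊆ U ∩ uIcc (x i) (max α (min β y)) := by
      rintro s ⟨hsU, hs⟩
      refine ⟨hsU, ?_⟩
      have hsI := hUI hsU
      rw [mem_uIcc] at hs ⊢
      rcases hs with ⟨a1, a2⟩ | ⟨a1, a2⟩
      · exact Or.inl ⟨a1, le_max_of_le_right (le_min hsI.2 a2)⟩
      · exact Or.inr ⟨max_le hsI.1 ((min_le_right _ _).trans a1), a2⟩
    have h3 : |x i - max α (min β y)| ≤ |x i - y| := by
      rcases le_total y (x i) with h | h
      · have e1 : max α (min β y) ≤ x i := max_le hxI.1 ((min_le_right _ _).trans h)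
        have e2 : y ≤ max α (min β y) := le_max_of_le_right (le_min (h.trans hxI.2) le_rfl)
        rw [abs_of_nonneg (sub_nonneg.2 e1), abs_of_nonneg (sub_nonneg.2 h)]
        linarith
      · have e1 : x i ≤ max α (min β y) := le_max_of_le_right (le_min hxI.2 h)
        have e2 : max α (min β y) ≤ y := max_le (hxI.1.trans h) (min_le_right _ _)
        rw [abs_of_nonpos (sub_nonpos.2 e1), abs_of_nonpos (sub_nonpos.2 h)]
        linarith
    calc volume.real (U ∩ uIcc (x i) y) ≤ volume.real (U ∩ uIcc (x i) (max α (min β y))) :=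
          measureReal_mono h2 (measure_ne_top_of_subset inter_subset_right
            isCompact_uIcc.measure_ne_top)
      _ ≤ lam⁻¹ * |x i - max α (min β y)| := h1
      _ ≤ _ := by gcongr
  have hleft : ρ.real (core E F lam ∩ K) ≤ (volume.withDensity m).real C := by
    refine ENNReal.toReal_mono (by finiteness) ?_
    rw [hν _ hCcl.measurableSet]
    exact measure_mono fun x hx => ⟨hcoreC x hx, hx.2⟩
  have hright : (volume.withDensity m).real Uᶜ ≤ ρ.real (Metric.cthickening ε E ∩ K) := by
    refine ENNReal.toReal_mono (by finiteness) ?_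
    have hnull : volume.withDensity m {α, β} = 0 :=
      withDensity_absolutelyContinuous _ _ ((Set.toFinite {α, β}).measure_zero _)
    have hout : volume.withDensity m (Icc α β)ᶜ = 0 := by
      rw [hν _ measurableSet_Icc.compl]
      convert measure_empty (μ := ρ)
      exact eq_empty_of_forall_notMem fun x hx => hx.1 (hKI x hx.2)
    have hsub : Uᶜ ⊆ P ∪ ({α, β} ∪ (Icc α β)ᶜ) := by
      intro s hs
      by_cases h1 : s ∈ P
      · exact Or.inl h1
      by_cases h2 : s ∈ Icc α β
      · right; left
        rcases h2.1.eq_or_lt with h | h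
        · exact Or.inl h.symm
        rcases h2.2.eq_or_lt with h' | h'
        · exact Or.inr h'
        exact (hs ⟨⟨h, h'⟩, h1⟩).elim
      · exact Or.inr (Or.inr h2)
    calc volume.withDensity m Uᶜ
        ≤ volume.withDensity m P + (volume.withDensity m {α, β} +
            volume.withDensity m (Icc α β)ᶜ) :=
          (measure_mono hsub).trans ((measure_union_le _ _).trans
            (add_le_add le_rfl (measure_union_le _ _)))
      _ = ρ ((fun x => x i) ⁻¹' P ∩ K) := by
          rw [hnull, hout, add_zero, add_zero, hν _ hP.isClosed.measurableSet]
      _ ≤ _ := by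
          refine measure_mono fun x hx => ⟨?_, hx.2⟩
          obtain ⟨e, ⟨heE, heK⟩, hex⟩ := hx.1
          exact Metric.mem_cthickening_of_dist_le x e ε E heE (hthin x hx.2 e heK hex.symm)
  have huniv : (volume.withDensity m).real univ = ρ.real K := by
    rw [Measure.real, hνuniv, Measure.real]
  rw [huniv] at key
  calc ρ.real (core E F lam ∩ K) * ρ.real K ^ (lam - 1)
      ≤ (volume.withDensity m).real C * ρ.real K ^ (lam - 1) := by gcongr
    _ ≤ _ := key
    _ ≤ _ := by
      have : 0 ≤ lam := by linarith
      gcongr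

/-- A log-concave function agrees almost everywhere with a measurable log-concave one. -/
theorem exists_measurable_logConcave_ae_eq {n : ℕ} {p : EuclideanSpace ℝ (Fin n) → ℝ}
    (hp0 : ∀ x, 0 ≤ p x)
    (hplc : ∀ x y : EuclideanSpace ℝ (Fin n), ∀ t ∈ Icc (0 : ℝ) 1,
      p x ^ t * p y ^ (1 - t) ≤ p (t • x + (1 - t) • y)) :
    ∃ g : EuclideanSpace ℝ (Fin n) → ENNReal, Measurable g ∧
      (∀ x y, ∀ t : ℝ, 0 < t → t < 1 → g x ^ t * g y ^ (1 - t) ≤ g (t • x + (1 - t) • y)) ∧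
      (fun x => ENNReal.ofReal (p x)) =ᵐ[volume] g := by
  set S := {x | 0 < p x} with hS
  have hlog : ∀ x ∈ S, ∀ y ∈ S, ∀ t ∈ Icc (0 : ℝ) 1, t • x + (1 - t) • y ∈ S ∧
      t * Real.log (p x) + (1 - t) * Real.log (p y) ≤ Real.log (p (t • x + (1 - t) • y)) := by
    intro x (hx : 0 < p x) y (hy : 0 < p y) t ht
    have h1 : 0 < p x ^ t := Real.rpow_pos_of_pos hx t
    have h2 : 0 < p y ^ (1 - t) := Real.rpow_pos_of_pos hy _
    have h := hplc x y t ht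
    refine ⟨(mul_pos h1 h2).trans_le h, ?_⟩
    rw [← Real.log_rpow hx, ← Real.log_rpow hy, ← Real.log_mul h1.ne' h2.ne']
    exact Real.log_le_log (mul_pos h1 h2) h
  have hSc : Convex ℝ S := by
    intro x hx y hy a b ha hb hab
    obtain rfl : b = 1 - a := by linarith
    exact (hlog x hx y hy a ⟨ha, by linarith⟩).1
  have hUc : Convex ℝ (interior S) := hSc.interior
  have hUS : interior S ⊆ S := interior_subset
  have hconc : ConcaveOn ℝ (interior S) fun x => Real.log (p x) := by
    refine ⟨hUc, fun x hx y hy a b ha hb hab => ?_⟩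
    obtain rfl : b = 1 - a := by linarith
    exact (hlog x (hUS hx) y (hUS hy) a ⟨ha, by linarith⟩).2
  have hcont : ContinuousOn p (interior S) :=
    (Real.continuous_exp.comp_continuousOn (hconc.continuousOn isOpen_interior)).congr
      fun x hx => (Real.exp_log (hUS hx)).symm
  refine ⟨(interior S).indicator fun x => ENNReal.ofReal (p x), ?_, fun x y t ht ht1 => ?_, ?_⟩
  · classical
    rw [← piecewise_eq_indicator]
    exact (ENNReal.continuous_ofReal.comp_continuousOn hcont).measurable_piecewise
      continuousOn_const isOpen_interior.measurableSet
  · by_cases hx : x ∈ interior S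
    · by_cases hy : y ∈ interior S
      · rw [indicator_of_mem hx, indicator_of_mem hy,
          indicator_of_mem (hUc hx hy ht.le (by linarith) (by ring)),
          ENNReal.ofReal_rpow_of_nonneg (hp0 x) ht.le,
          ENNReal.ofReal_rpow_of_nonneg (hp0 y) (by linarith),
          ← ENNReal.ofReal_mul (Real.rpow_nonneg (hp0 x) t)]
        exact ENNReal.ofReal_le_ofReal (hplc x y t ⟨ht.le, ht1.le⟩)
      · rw [indicator_of_notMem hy, ENNReal.zero_rpow_of_pos (by linarith), mul_zero]
        exact zero_le
    · rw [indicator_of_notMem hx, ENNReal.zero_rpow_of_pos ht, zero_mul]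
      exact zero_le
  · have h0 : ∀ᵐ x ∂(volume : Measure (EuclideanSpace ℝ (Fin n))), x ∉ frontier S :=
      measure_eq_zero_iff_ae_notMem.1 (hSc.addHaar_frontier volume)
    filter_upwards [h0] with x hx
    by_cases hxU : x ∈ interior S
    · rw [indicator_of_mem hxU]
    · rw [indicator_of_notMem hxU, ENNReal.ofReal_eq_zero]
      by_contra! h
      exact hx ⟨subset_closure h, hxU⟩

/-- The affine function on the `(i, j)` coordinate plane vanishing at `q` whose gradient has
direction `φ`. -/
noncomputable def planarForm {n : ℕ} (i j : Fin n) (q : ℝ × ℝ) (φ : ℝ)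
    (x : EuclideanSpace ℝ (Fin n)) : ℝ :=
  Real.cos φ * (x i - q.1) + Real.sin φ * (x j - q.2)

theorem continuous_planarForm {n : ℕ} (i j : Fin n) (q : ℝ × ℝ) (φ : ℝ) :
    Continuous (planarForm i j q φ) := by
  unfold planarForm
  fun_prop

theorem continuous_planarForm_angle {n : ℕ} (i j : Fin n) (q : ℝ × ℝ)
    (x : EuclideanSpace ℝ (Fin n)) : Continuous fun φ => planarForm i j q φ x := by
  unfold planarForm
  fun_prop

theorem planarForm_add_pi {n : ℕ} (i j : Fin n) (q : ℝ × ℝ) (φ : ℝ)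
    (x : EuclideanSpace ℝ (Fin n)) : planarForm i j q (φ + Real.pi) x = -planarForm i j q φ x := by
  simp only [planarForm, Real.cos_add_pi, Real.sin_add_pi]
  ring

theorem convex_planarForm_nonneg {n : ℕ} (i j : Fin n) (q : ℝ × ℝ) (φ : ℝ) :
    Convex ℝ {x | 0 ≤ planarForm i j q φ x} := by
  intro x hx y hy a b ha hb hab
  have h : planarForm i j q φ (a • x + b • y) =
      a * planarForm i j q φ x + b * planarForm i j q φ y := by
    obtain rfl : b = 1 - a := by linarith
    simp only [planarForm, PiLp.add_apply, PiLp.smul_apply, smul_eq_mul]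
    ring
  rw [Set.mem_ofPred_eq, h]
  exact add_nonneg (mul_nonneg ha hx) (mul_nonneg hb hy)

theorem volume_planarForm_eq_zero {n : ℕ} {i j : Fin n} (hij : i ≠ j) (q : ℝ × ℝ) (φ : ℝ) :
    volume {x : EuclideanSpace ℝ (Fin n) | planarForm i j q φ x = 0} = 0 := by
  set ℓ : EuclideanSpace ℝ (Fin n) →ₗ[ℝ] ℝ :=
    { toFun := fun x => Real.cos φ * x i + Real.sin φ * x j
      map_add' := fun x y => by simp only [PiLp.add_apply]; ring
      map_smul' := fun c x => by
        simp only [PiLp.smul_apply, smul_eq_mul, RingHom.id_apply]; ring } with hℓ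
  have hker : ℓ.ker ≠ ⊤ := by
    intro h
    have h1 : ℓ (EuclideanSpace.single i (Real.cos φ) + EuclideanSpace.single j (Real.sin φ)) = 0 := by
      rw [← LinearMap.mem_ker, h]
      exact Submodule.mem_top
    have h2 : Real.cos φ * Real.cos φ + Real.sin φ * Real.sin φ = 0 := by
      simpa [hℓ, hij, hij.symm] using h1
    nlinarith [Real.sin_sq_add_cos_sq φ]
  have hset : {x : EuclideanSpace ℝ (Fin n) | planarForm i j q φ x = 0} =
      (fun x => x + (EuclideanSpace.single i (-q.1) + EuclideanSpace.single j (-q.2))) ⁻¹'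
        (ℓ.ker : Set (EuclideanSpace ℝ (Fin n))) := by
    ext x
    simp [hℓ, planarForm, hij, hij.symm, sub_eq_add_neg]
  rw [hset, measure_preimage_add_right]
  exact Measure.addHaar_submodule volume _ hker

theorem continuous_measureReal_inter_planarForm_nonneg {n : ℕ} {i j : Fin n} (hij : i ≠ j)
    (q : ℝ × ℝ) {ρ : Measure (EuclideanSpace ℝ (Fin n))} [IsFiniteMeasure ρ] (hρ : ρ ≪ volume)
    {A : Set (EuclideanSpace ℝ (Fin n))} (hA : MeasurableSet A) :
    Continuous fun φ => ρ.real (A ∩ {x | 0 ≤ planarForm i j q φ x}) := by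
  have hm : ∀ φ, MeasurableSet (A ∩ {x | 0 ≤ planarForm i j q φ x}) := fun φ =>
    hA.inter (isClosed_le continuous_const (continuous_planarForm i j q φ)).measurableSet
  refine continuous_iff_continuousAt.2 fun φ => ?_
  refine (ENNReal.tendsto_toReal (measure_ne_top _ _)).comp
    (tendsto_measure_of_ae_tendsto_indicator_of_isFiniteMeasure _ (hm φ) hm ?_)
  have h0 : ∀ᵐ x ∂ρ, planarForm i j q φ x ≠ 0 :=
    measure_eq_zero_iff_ae_notMem.1 (hρ (volume_planarForm_eq_zero hij q φ))
  filter_upwards [h0] with x hx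
  have hc := (continuous_planarForm_angle i j q x).tendsto φ
  rcases lt_or_gt_of_ne hx with hx | hx
  · filter_upwards [hc.eventually (gt_mem_nhds hx)] with ψ hψ
    simp [hx.not_ge, hψ.not_ge]
  · filter_upwards [hc.eventually (lt_mem_nhds hx)] with ψ hψ
    simp [hx.le, hψ.le]

theorem measureReal_inter_planarForm_add {n : ℕ} {i j : Fin n} (hij : i ≠ j)
    (q : ℝ × ℝ) {ρ : Measure (EuclideanSpace ℝ (Fin n))} [IsFiniteMeasure ρ] (hρ : ρ ≪ volume)
    (A : Set (EuclideanSpace ℝ (Fin n))) (φ : ℝ) :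
    ρ.real (A ∩ {x | 0 ≤ planarForm i j q φ x}) +
      ρ.real (A ∩ {x | 0 ≤ planarForm i j q (φ + Real.pi) x}) = ρ.real A := by
  have hm : MeasurableSet {x : EuclideanSpace ℝ (Fin n) | 0 ≤ planarForm i j q φ x} :=
    (isClosed_le continuous_const (continuous_planarForm i j q φ)).measurableSet
  rw [← measureReal_inter_add_sdiff hm (s := A)]
  congr 1
  refine measureReal_congr ?_
  have h0 : ∀ᵐ x ∂ρ, planarForm i j q φ x ≠ 0 :=
    measure_eq_zero_iff_ae_notMem.1 (hρ (volume_planarForm_eq_zero hij q φ))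
  filter_upwards [h0] with x hx
  refine propext (and_congr_right fun _ => ?_)
  change 0 ≤ planarForm i j q (φ + Real.pi) x ↔ ¬ 0 ≤ planarForm i j q φ x
  rw [planarForm_add_pi, not_le, neg_nonneg]
  exact ⟨fun h => h.lt_of_ne hx, le_of_lt⟩

/-- Some half-plane with prescribed boundary point keeps a given balance between `A` and `K`
without decreasing the proportion of `B` below its threshold. -/
theorem exists_planarForm_bisection {n : ℕ} {i j : Fin n} (hij : i ≠ j)
    (q : ℝ × ℝ) {ρ : Measure (EuclideanSpace ℝ (Fin n))} [IsFiniteMeasure ρ] (hρ : ρ ≪ volume)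
    {A B K : Set (EuclideanSpace ℝ (Fin n))} (hA : MeasurableSet A) (hK : MeasurableSet K)
    {a b : ℝ} (hAK : ρ.real (A ∩ K) = a * ρ.real K) (hBK : b * ρ.real K < ρ.real (B ∩ K)) :
    ∃ φ, ρ.real (A ∩ (K ∩ {x | 0 ≤ planarForm i j q φ x})) =
        a * ρ.real (K ∩ {x | 0 ≤ planarForm i j q φ x}) ∧
      b * ρ.real (K ∩ {x | 0 ≤ planarForm i j q φ x}) <
        ρ.real (B ∩ (K ∩ {x | 0 ≤ planarForm i j q φ x})) := by
  simp only [← inter_assoc]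
  set u : ℝ → ℝ := fun φ => ρ.real (A ∩ K ∩ {x | 0 ≤ planarForm i j q φ x}) -
    a * ρ.real (K ∩ {x | 0 ≤ planarForm i j q φ x}) with hu
  have huc : Continuous u :=
    (continuous_measureReal_inter_planarForm_nonneg hij q hρ (hA.inter hK)).sub
      ((continuous_measureReal_inter_planarForm_nonneg hij q hρ hK).const_mul a)
  have huπ : ∀ φ, u φ + u (φ + Real.pi) = 0 := fun φ => by
    have h1 := measureReal_inter_planarForm_add hij q hρ (A ∩ K) φ
    have h2 := measureReal_inter_planarForm_add hij q hρ K φ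
    rw [hAK, ← h2] at h1
    simp only [hu]
    linarith
  obtain ⟨φ, hφ⟩ : ∃ φ, u φ = 0 := by
    have h0 := huπ 0
    refine mem_range_of_exists_le_of_exists_ge huc ?_ ?_
    · rcases le_total (u 0) 0 with h | h
      · exact ⟨_, h⟩
      · exact ⟨0 + Real.pi, by linarith⟩
    · rcases le_total 0 (u 0) with h | h
      · exact ⟨_, h⟩
      · exact ⟨0 + Real.pi, by linarith⟩
  have hφ' : u (φ + Real.pi) = 0 := by linarith [huπ φ]
  have h2 := measureReal_inter_planarForm_add hij q hρ K φ
  have h3 := measureReal_inter_planarForm_add hij q hρ (B ∩ K) φ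
  by_cases h : b * ρ.real (K ∩ {x | 0 ≤ planarForm i j q φ x}) <
      ρ.real (B ∩ K ∩ {x | 0 ≤ planarForm i j q φ x})
  · exact ⟨φ, by simp only [hu] at hφ; linarith, h⟩
  · refine ⟨φ + Real.pi, by simp only [hu] at hφ'; linarith, ?_⟩
    rw [← h2, ← h3, mul_add] at hBK
    linarith

/-- Iterating refinement steps indexed by a countable type. -/
theorem exists_antitone_refinement {α ι : Type*} [Countable ι] [Nonempty ι]
    {P : Set α → Prop} {Q : ι → Set α → Prop} {F : Set α} (hF : P F)
    (hstep : ∀ t K, P K → ∃ K' ⊆ K, P K' ∧ Q t K') :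
    ∃ K : ℕ → Set α, Antitone K ∧ K 0 = F ∧ (∀ n, P (K n)) ∧ ∀ t, ∃ n, Q t (K n) := by
  obtain ⟨e, he⟩ := exists_surjective_nat ι
  choose! s hsK hsP hsQ using hstep
  let K : ℕ → Set α := fun n => Nat.rec F (fun m L => s (e m) L) n
  have hP : ∀ n, P (K n) := fun n => by
    induction n with
    | zero => exact hF
    | succ m ih => exact hsP _ _ ih
  refine ⟨K, antitone_nat_of_succ_le fun m => hsK _ _ (hP m), rfl, hP, fun t => ?_⟩
  obtain ⟨m, rfl⟩ := he t
  exact ⟨m + 1, hsQ _ _ (hP m)⟩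

/-- A nondegenerate triangle contains, in its interior, a point with rational coordinates. -/
theorem exists_rat_mem_triangle {a c d e f : ℝ} (hcd : c ≠ d) (hae : a ≠ e) :
    ∃ q : ℚ × ℚ, ∃ s t u : ℝ, 0 < s ∧ 0 < t ∧ 0 < u ∧ s + t + u = 1 ∧
      (q.1 : ℝ) = s * a + t * a + u * e ∧ (q.2 : ℝ) = s * c + t * d + u * f := by
  have hea : e - a ≠ 0 := sub_ne_zero.2 hae.symm
  have hdc : d - c ≠ 0 := sub_ne_zero.2 hcd.symm
  set u : ℝ × ℝ → ℝ := fun q => (q.1 - a) / (e - a) with hu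
  set t : ℝ × ℝ → ℝ := fun q => (q.2 - c - u q * (f - c)) / (d - c) with ht
  have huc : Continuous u := by fun_prop
  have htc : Continuous t := by fun_prop
  have hO : IsOpen {q : ℝ × ℝ | 0 < u q ∧ 0 < t q ∧ u q + t q < 1} :=
    (isOpen_lt continuous_const huc).inter
      ((isOpen_lt continuous_const htc).inter (isOpen_lt (huc.add htc) continuous_const))
  have hne : {q : ℝ × ℝ | 0 < u q ∧ 0 < t q ∧ u q + t q < 1}.Nonempty := by
    refine ⟨(a + (e - a) / 3, c + (d - c) / 3 + (f - c) / 3), ?_⟩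
    have h1 : u (a + (e - a) / 3, c + (d - c) / 3 + (f - c) / 3) = 1 / 3 := by
      simp only [hu]; field_simp; ring
    have h2 : t (a + (e - a) / 3, c + (d - c) / 3 + (f - c) / 3) = 1 / 3 := by
      simp only [ht, h1]; field_simp; ring
    simp only [Set.mem_ofPred_eq, h1, h2]
    norm_num
  obtain ⟨q, hq1, hq2, hq3⟩ :=
    ((Rat.denseRange_cast (𝕜 := ℝ)).prodMap (Rat.denseRange_cast (𝕜 := ℝ))).exists_mem_open hO hne
  set Q : ℝ × ℝ := Prod.map Rat.cast Rat.cast q with hQ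
  refine ⟨q, 1 - t Q - u Q, t Q, u Q, by linarith, hq2, hq1, by ring, ?_, ?_⟩
  · have h : u Q * (e - a) = q.1 - a := by
      simp only [hu, hQ]; field_simp; rfl
    linarith
  · have h : t Q * (d - c) = q.2 - c - u Q * (f - c) := by
      simp only [ht, hQ]; field_simp; rfl
    linarith

/-- A set which has every rational point of every coordinate plane on the boundary of a half-plane
containing its projection is injectively parametrized by one of the coordinates. -/
theorem exists_injOn_coordinate {k : ℕ} {S : Set (EuclideanSpace ℝ (Fin (k + 1)))}
    (hS : ∀ i j, i ≠ j → ∀ q : ℚ × ℚ, ∃ φ, ∀ x ∈ S, 0 ≤ planarForm i j ((q.1 : ℝ), (q.2 : ℝ)) φ x) :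
    ∃ i, InjOn (fun x => x i) S := by
  by_contra! hinj
  obtain ⟨i, x₀, hx₀, y₀, hy₀, hi⟩ : ∃ i, ∃ x ∈ S, ∃ y ∈ S, x i ≠ y i := by
    have h := hinj 0
    simp only [InjOn, not_forall] at h
    obtain ⟨x, hx, y, hy, -, hxy⟩ := h
    by_contra! hc
    exact hxy (PiLp.ext fun i => hc i x hx y hy)
  have h := hinj i
  simp only [InjOn, not_forall] at h
  obtain ⟨x, hx, y, hy, hxyi, hxy⟩ := h
  obtain ⟨j, hj⟩ : ∃ j, x j ≠ y j := by
    by_contra! hc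
    exact hxy (PiLp.ext hc)
  have hij : i ≠ j := by
    rintro rfl
    exact hj hxyi
  obtain ⟨z, hz, hzi⟩ : ∃ z ∈ S, x i ≠ z i := by
    by_contra! hc
    exact hi ((hc x₀ hx₀).symm.trans (hc y₀ hy₀))
  obtain ⟨q, s, t, u, hs, ht, hu, hstu, hq1, hq2⟩ := exists_rat_mem_triangle (f := z j) hj hzi
  obtain ⟨φ, hφ⟩ := hS i j hij q
  have hX := hφ x hx
  have hY := hφ y hy
  have hZ := hφ z hz
  have hsum : s * planarForm i j ((q.1 : ℝ), (q.2 : ℝ)) φ x +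
      t * planarForm i j ((q.1 : ℝ), (q.2 : ℝ)) φ y +
      u * planarForm i j ((q.1 : ℝ), (q.2 : ℝ)) φ z = 0 := by
    have hxyi' : x i = y i := hxyi
    obtain rfl : s = 1 - t - u := by linarith
    simp only [planarForm, hq1, hq2, ← hxyi']
    ring
  have hsX := mul_nonneg hs.le hX
  have htY := mul_nonneg ht.le hY
  have huZ := mul_nonneg hu.le hZ
  have hX0 : planarForm i j ((q.1 : ℝ), (q.2 : ℝ)) φ x = 0 :=
    (mul_eq_zero.1 (by linarith : s * planarForm i j ((q.1 : ℝ), (q.2 : ℝ)) φ x = 0)).resolve_left hs.ne'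
  have hY0 : planarForm i j ((q.1 : ℝ), (q.2 : ℝ)) φ y = 0 :=
    (mul_eq_zero.1 (by linarith : t * planarForm i j ((q.1 : ℝ), (q.2 : ℝ)) φ y = 0)).resolve_left ht.ne'
  have hxyi' : x i = y i := hxyi
  simp only [planarForm, ← hxyi'] at hX0 hY0
  have hsin : Real.sin φ = 0 := by
    have : Real.sin φ * (x j - y j) = 0 := by linarith
    exact (mul_eq_zero.1 this).resolve_right (sub_ne_zero.2 hj)
  have hcos : Real.cos φ = 0 := by
    rw [hsin, zero_mul, add_zero] at hX0
    refine (mul_eq_zero.1 hX0).resolve_right ?_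
    have : x i - (q.1 : ℝ) = u * (x i - z i) := by
      obtain rfl : s = 1 - t - u := by linarith
      rw [hq1]; ring
    rw [this]
    exact mul_ne_zero hu.ne' (sub_ne_zero.2 hzi)
  have := Real.sin_sq_add_cos_sq φ
  rw [hsin, hcos] at this
  norm_num at this

/-- A decreasing sequence of compact sets is eventually thin along the fibres of a continuous map
that is injective on the intersection. -/
theorem exists_dist_le_of_injOn_iInter {α β : Type*} [MetricSpace α] [TopologicalSpace β] [T2Space β]
    {K : ℕ → Set α} (hK : Antitone K) (hKc : ∀ n, IsCompact (K n)) {π : α → β} (hπ : Continuous π)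
    (hinj : InjOn π (⋂ n, K n)) {ε : ℝ} (hε : 0 < ε) :
    ∃ n, ∀ x ∈ K n, ∀ y ∈ K n, π x = π y → dist x y ≤ ε := by
  by_contra! hcon
  set T : ℕ → Set (α × α) := fun n => K n ×ˢ K n ∩ {z | π z.1 = π z.2 ∧ ε ≤ dist z.1 z.2} with hT
  have hcl : IsClosed {z : α × α | π z.1 = π z.2 ∧ ε ≤ dist z.1 z.2} :=
    (isClosed_eq (hπ.comp continuous_fst) (hπ.comp continuous_snd)).inter
      (isClosed_le continuous_const continuous_dist)
  have hTc : ∀ n, IsCompact (T n) := fun n => ((hKc n).prod (hKc n)).inter_right hcl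
  obtain ⟨z, hz⟩ := IsCompact.nonempty_iInter_of_sequence_nonempty_isCompact_isClosed T
    (fun n => inter_subset_inter_left _ (prod_mono (hK n.le_succ) (hK n.le_succ)))
    (fun n => by
      obtain ⟨x, hx, y, hy, hxy, hd⟩ := hcon n
      exact ⟨(x, y), ⟨hx, hy⟩, hxy, hd.le⟩)
    (hTc 0) fun n => (hTc n).isClosed
  rw [mem_iInter] at hz
  have h := hinj (mem_iInter.2 fun n => (hz n).1.1) (mem_iInter.2 fun n => (hz n).1.2) (hz 0).2.1
  have hd := (hz 0).2.2
  rw [h, dist_self] at hd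
  linarith

/-- The core inequality for log-concave densities, weakened by a thickening of `E`. -/
theorem core_real_le_of_thickening {k : ℕ}
    {g : EuclideanSpace ℝ (Fin (k + 1)) → ENNReal} (hg : Measurable g)
    (hlc : ∀ x y, ∀ t : ℝ, 0 < t → t < 1 → g x ^ t * g y ^ (1 - t) ≤ g (t • x + (1 - t) • y))
    {ρ : Measure (EuclideanSpace ℝ (Fin (k + 1)))} (hρ : ρ = volume.withDensity g)
    [IsFiniteMeasure ρ] {E F : Set (EuclideanSpace ℝ (Fin (k + 1)))} {lam ε a : ℝ}
    (hlam : 1 < lam) (hE : IsClosed E) (hFc : IsCompact F) (hF : Convex ℝ F) (hEF : E ⊆ F)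
    (hε : 0 < ε) (ha : 0 ≤ a) (haF : ρ.real (Metric.cthickening ε E ∩ F) = a * ρ.real F) :
    ρ.real (core E F lam) ≤ a ^ lam * ρ.real F := by
  by_contra! hcon
  have hac : ρ ≪ volume := hρ ▸ withDensity_absolutelyContinuous _ _
  have hCF : core E F lam ∩ F = core E F lam := inter_eq_left.2 fun x hx => hEF hx.1
  rw [← hCF] at hcon
  obtain ⟨K, hKa, hK0, hKP, hKQ⟩ := exists_antitone_refinement (F := F)
    (ι := (Fin (k + 1) × Fin (k + 1)) × (ℚ × ℚ))
    (P := fun K => (IsCompact K ∧ Convex ℝ K ∧ K ⊆ F) ∧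
      ρ.real (Metric.cthickening ε E ∩ K) = a * ρ.real K ∧
      a ^ lam * ρ.real K < ρ.real (core E F lam ∩ K))
    (Q := fun t K => t.1.1 ≠ t.1.2 → ∃ φ, ∀ x ∈ K,
      0 ≤ planarForm t.1.1 t.1.2 ((t.2.1 : ℝ), (t.2.2 : ℝ)) φ x)
    ⟨⟨hFc, hF, Subset.rfl⟩, haF, hcon⟩ (by
      rintro ⟨⟨i, j⟩, q⟩ K hP
      obtain ⟨⟨hKc, hKv, hKF⟩, hA, hB⟩ := hP
      by_cases hij : i = j
      · exact ⟨K, Subset.rfl, ⟨⟨hKc, hKv, hKF⟩, hA, hB⟩, fun h => absurd hij h⟩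
      · obtain ⟨φ, hφA, hφB⟩ := exists_planarForm_bisection hij ((q.1 : ℝ), (q.2 : ℝ)) hac
          Metric.isClosed_cthickening.measurableSet hKc.isClosed.measurableSet hA hB
        exact ⟨_, inter_subset_left,
          ⟨⟨hKc.inter_right (isClosed_le continuous_const (continuous_planarForm i j _ φ)),
            hKv.inter (convex_planarForm_nonneg i j _ φ), inter_subset_left.trans hKF⟩, hφA, hφB⟩,
          fun _ => ⟨φ, fun x hx => hx.2⟩⟩)
  obtain ⟨i, hi⟩ := exists_injOn_coordinate (S := ⋂ n, K n) fun i j hij q => by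
    obtain ⟨n, hn⟩ := hKQ ((i, j), q)
    obtain ⟨φ, hφ⟩ := hn hij
    exact ⟨φ, fun x hx => hφ x (mem_iInter.1 hx n)⟩
  obtain ⟨n, hn⟩ := exists_dist_le_of_injOn_iInter hKa (fun n => (hKP n).1.1) (by fun_prop) hi hε
  obtain ⟨⟨hKc, hKv, hKF⟩, hA, hB⟩ := hKP n
  have hKpos : 0 < ρ.real (K n) := by
    refine measureReal_nonneg.lt_of_ne fun h => ?_
    have h' : ρ.real (core E F lam ∩ K n) = 0 :=
      le_antisymm (h ▸ measureReal_mono inter_subset_right) measureReal_nonneg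
    rw [← h, h'] at hB
    simp at hB
  have hKne : (K n).Nonempty := by
    by_contra! h
    rw [h] at hKpos
    simp at hKpos
  have hthin := core_real_le_of_thin i hg hlc hρ hlam hE hKc hKv hKF hKne hn
  rw [hA, Real.mul_rpow ha hKpos.le] at hthin
  have h1 : ρ.real (K n) ^ lam = ρ.real (K n) * ρ.real (K n) ^ (lam - 1) := by
    rw [Real.rpow_sub_one hKpos.ne']
    field_simp
  rw [h1, ← mul_assoc] at hthin
  exact absurd (le_of_mul_le_mul_right hthin (Real.rpow_pos_of_pos hKpos _)) (not_le.2 hB)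

theorem core_measureReal_div_le {k : ℕ}
    {g : EuclideanSpace ℝ (Fin (k + 1)) → ENNReal} (hg : Measurable g)
    (hlc : ∀ x y, ∀ t : ℝ, 0 < t → t < 1 → g x ^ t * g y ^ (1 - t) ≤ g (t • x + (1 - t) • y))
    {ρ : Measure (EuclideanSpace ℝ (Fin (k + 1)))} (hρ : ρ = volume.withDensity g)
    [IsFiniteMeasure ρ] {E F : Set (EuclideanSpace ℝ (Fin (k + 1)))} {lam : ℝ}
    (hlam : 1 < lam) (hE : IsClosed E) (hFc : IsCompact F) (hF : Convex ℝ F) (hEF : E ⊆ F)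
    (hF0 : 0 < ρ.real F) :
    ρ.real (core E F lam) / ρ.real F ≤ (ρ.real E / ρ.real F) ^ lam := by
  have hlim : Tendsto (fun r => ((ρ.restrict F) (Metric.cthickening r E)).toReal) (𝓝 0)
      (𝓝 ((ρ.restrict F) E).toReal) :=
    (ENNReal.tendsto_toReal (measure_ne_top _ _)).comp
      (tendsto_measure_cthickening_of_isClosed ⟨1, one_pos, measure_ne_top _ _⟩ hE)
  have hlim' : Tendsto
      (fun r => (((ρ.restrict F) (Metric.cthickening r E)).toReal / ρ.real F) ^ lam) (𝓝[>] 0)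
      (𝓝 ((ρ.real E / ρ.real F) ^ lam)) := by
    rw [Measure.restrict_apply hE.measurableSet, inter_eq_left.2 hEF] at hlim
    exact ((hlim.div_const _).rpow_const (Or.inr (by linarith))).mono_left nhdsWithin_le_nhds
  refine ge_of_tendsto hlim' ?_
  filter_upwards [self_mem_nhdsWithin] with ε hε
  rw [Measure.restrict_apply Metric.isClosed_cthickening.measurableSet, div_le_iff₀ hF0]
  exact core_real_le_of_thickening hg hlc hρ hlam hE hFc hF hEF hε
    (div_nonneg measureReal_nonneg hF0.le) (div_mul_cancel₀ _ hF0.ne').symm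

end

theorem geometric_KLS_logconcave {n : ℕ} (p : EuclideanSpace ℝ (Fin n) → ℝ)
    (hp0 : ∀ x, 0 ≤ p x)
    (hplc : ∀ x y : EuclideanSpace ℝ (Fin n), ∀ t ∈ Set.Icc (0 : ℝ) 1,
      p x ^ t * p y ^ (1 - t) ≤ p (t • x + (1 - t) • y))
    (μ : Measure (EuclideanSpace ℝ (Fin n)))
    (hμ : μ = volume.withDensity (fun x => ENNReal.ofReal (p x)))
    (hμfin : IsFiniteMeasure μ)
    (F E : Set (EuclideanSpace ℝ (Fin n)))
    (hFcomp : IsCompact F) (hFconv : Convex ℝ F)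
    (hμF : 0 < μ F) (hμF' : μ F < ⊤)
    (hEclosed : IsClosed E) (hEF : E ⊆ F) (lam : ℝ) (hlam : 1 < lam) :
    (μ (core E F lam)).toReal / (μ F).toReal ≤
      ((μ E).toReal / (μ F).toReal) ^ lam := by
  have hF0 : 0 < μ.real F := ENNReal.toReal_pos hμF.ne' hμF'.ne
  cases n with
  | zero =>
    rcases E.eq_empty_or_nonempty with rfl | hE
    · have hC : core ∅ F lam = ∅ := Set.eq_empty_of_forall_notMem fun x hx => hx.1
      rw [hC, measure_empty, ENNReal.toReal_zero, zero_div, Real.zero_rpow (by linarith)]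
    · obtain rfl : E = F := hEF.antisymm fun x _ => by
        obtain ⟨y, hy⟩ := hE
        rwa [Subsingleton.elim x y]
      change μ.real _ / μ.real _ ≤ (μ.real _ / μ.real _) ^ lam
      rw [div_self hF0.ne', Real.one_rpow]
      exact div_le_one_of_le₀ (measureReal_mono fun x hx => hx.1) hF0.le
  | succ k =>
    obtain ⟨g, hg, hlc, hpg⟩ := exists_measurable_logConcave_ae_eq hp0 hplc
    exact core_measureReal_div_le hg hlc (hμ.trans (withDensity_congr_ae hpg)) hlam hEclosed
      hFcomp hFconv hEF hF0
end

section
/- Let I ⊆ ℝ be a compact interval and let f : I → [0,∞) be a logarithmically concave function (f(tx+(1−t)y) ≥ f(x)^t f(y)^{1−t} for x,y ∈ I, t ∈ [0,1]) that does not vanish at interior points of I. Let E ⊆ I be a measurable set and fix λ > 1. Define E_{λ,I} = {x ∈ E : for every subinterval J ⊆ I with x ∈ J, |E ∩ J| ≥ ((λ−1)/λ)|J|}. Then (∫_{E_{λ,I}} f) / (∫_I f) ≤ ((∫_E f) / (∫_I f))^λ. -/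
open MeasureTheory

/-- The one-dimensional core `E_{λ,I}` : points `x ∈ E` such that for every
subinterval `J = [c,d] ⊆ I` containing `x`, `|E ∩ J| ≥ ((λ-1)/λ)·|J|`. -/
noncomputable def core1 (E I : Set ℝ) (lam : ℝ) : Set ℝ :=
  {x | x ∈ E ∧ ∀ c d : ℝ, x ∈ Set.Icc c d → Set.Icc c d ⊆ I →
    ((lam - 1) / lam) * (d - c) ≤ (volume (E ∩ Set.Icc c d)).toReal}

/-- Logarithmic concavity of a nonnegative function on a set of reals. -/
def LogConcOn (s : Set ℝ) (f : ℝ → ℝ) : Prop :=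
  (∀ x ∈ s, 0 ≤ f x) ∧ ∀ x ∈ s, ∀ y ∈ s, ∀ t ∈ Set.Icc (0 : ℝ) 1,
    f x ^ t * f y ^ (1 - t) ≤ f (t * x + (1 - t) * y)

namespace LogConcOn

variable {f : ℝ → ℝ} {s t : Set ℝ} {a b : ℝ}

lemma mono (h : LogConcOn s f) (hts : t ⊆ s) : LogConcOn t f :=
  ⟨fun x hx => h.1 x (hts hx), fun x hx y hy => h.2 x (hts hx) y (hts hy)⟩

lemma comp_neg (h : LogConcOn (Set.Icc a b) f) :
    LogConcOn (Set.Icc (-b) (-a)) (fun x => f (-x)) := by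
  have hm : ∀ x ∈ Set.Icc (-b) (-a), -x ∈ Set.Icc a b := fun x hx =>
    ⟨by linarith [hx.2], by linarith [hx.1]⟩
  refine ⟨fun x hx => h.1 _ (hm x hx), fun x hx y hy t ht => ?_⟩
  refine (h.2 _ (hm x hx) _ (hm y hy) t ht).trans_eq ?_
  congr 1
  ring

lemma mul_le_mul_shift (h : LogConcOn (Set.Icc a b) f) {x z d : ℝ} (hx : x ∈ Set.Icc a b)
    (hz : z ∈ Set.Icc a b) (hd : 0 ≤ d) (hxz : x + d ≤ z) :
    f x * f z ≤ f (x + d) * f (z - d) := by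
  rcases hd.eq_or_lt with rfl | hd
  · simp
  have hpos : 0 < z - x := by linarith
  set t := (z - x - d) / (z - x) with ht
  have ht0 : 0 ≤ t := div_nonneg (by linarith) hpos.le
  have ht1 : t ≤ 1 := by rw [ht, div_le_one hpos]; linarith
  have htm : t * (z - x) = z - x - d := by rw [ht]; field_simp
  have hfx := h.1 x hx
  have hfz := h.1 z hz
  have h1 := h.2 x hx z hz t ⟨ht0, ht1⟩
  have h2 := h.2 x hx z hz (1 - t) ⟨by linarith, by linarith⟩
  rw [show t * x + (1 - t) * z = x + d by linarith] at h1
  rw [show (1 - t) * x + (1 - (1 - t)) * z = z - d by linarith] at h2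
  have e : ∀ y : ℝ, 0 ≤ y → y ^ t * y ^ (1 - t) = y := fun y hy => by
    rw [← Real.rpow_add_of_nonneg hy ht0 (by linarith)]; simp
  calc f x * f z = (f x ^ t * f x ^ (1 - t)) * (f z ^ t * f z ^ (1 - t)) := by
        rw [e _ hfx, e _ hfz]
    _ = (f x ^ t * f z ^ (1 - t)) * (f x ^ (1 - t) * f z ^ (1 - (1 - t))) := by
        rw [show 1 - (1 - t) = t by ring]; ring
    _ ≤ _ := by
        refine mul_le_mul h1 h2 (by positivity) (le_trans (by positivity) h1)

lemma continuousOn (h : LogConcOn (Set.Icc a b) f) (hpos : ∀ x ∈ Set.Ioo a b, f x ≠ 0) :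
    ContinuousOn f (Set.Ioo a b) := by
  have hp : ∀ x ∈ Set.Ioo a b, 0 < f x := fun x hx =>
    lt_of_le_of_ne (h.1 x (Set.Ioo_subset_Icc_self hx)) (hpos x hx).symm
  have hc : ConcaveOn ℝ (Set.Ioo a b) (fun x => Real.log (f x)) := by
    refine ⟨convex_Ioo a b, fun x hx y hy t u ht hu htu => ?_⟩
    obtain rfl : u = 1 - t := by linarith
    have := h.2 x (Set.Ioo_subset_Icc_self hx) y (Set.Ioo_subset_Icc_self hy) t
      ⟨ht, by linarith⟩
    have hx' := hp x hx
    have hy' := hp y hy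
    have := Real.log_le_log (by positivity) this
    rwa [Real.log_mul (by positivity) (by positivity), Real.log_rpow hx', Real.log_rpow hy'] at this
  refine (Real.continuous_exp.comp_continuousOn (hc.continuousOn isOpen_Ioo)).congr fun x hx => ?_
  simp [Real.exp_log (hp x hx)]

lemma mul_tail_le (h : LogConcOn (Set.Icc a b) f) (hi : IntegrableOn f (Set.Icc a b))
    {x y : ℝ} (hax : a ≤ x) (hxy : x ≤ y) (hyb : y ≤ b) :
    f x * (∫ s in y..b, f s) ≤ f y * ∫ s in x..b, f s := by
  have hii : ∀ c d, a ≤ c → c ≤ d → d ≤ b → IntervalIntegrable f volume c d := fun c d h1 h2 h3 =>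
    (intervalIntegrable_iff_integrableOn_Icc_of_le h2).2 (hi.mono_set (Set.Icc_subset_Icc h1 h3))
  have hfy : 0 ≤ f y := h.1 y ⟨hax.trans hxy, hyb⟩
  have h1 : ∫ s in y..b, f (s - (y - x)) = ∫ s in x..(b - (y - x)), f s := by
    rw [intervalIntegral.integral_comp_sub_right]; congr 1; ring
  have h2 : ∫ s in x..(b - (y - x)), f s ≤ ∫ s in x..b, f s := by
    rw [← intervalIntegral.integral_add_adjacent_intervals
      (hii x (b - (y - x)) hax (by linarith) (by linarith))
      (hii (b - (y - x)) b (by linarith) (by linarith) le_rfl)]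
    have : 0 ≤ ∫ s in (b - (y - x))..b, f s :=
      intervalIntegral.integral_nonneg (by linarith) fun u hu => h.1 u ⟨by linarith [hu.1], hu.2⟩
    linarith
  have h3 : IntervalIntegrable (fun s => f (s - (y - x))) volume y b := by
    have := (hii x (b - (y - x)) hax (by linarith) (by linarith)).comp_sub_right (y - x)
    convert this using 1 <;> ring
  calc f x * (∫ s in y..b, f s) = ∫ s in y..b, f x * f s := by
        rw [intervalIntegral.integral_const_mul]
    _ ≤ ∫ s in y..b, f y * f (s - (y - x)) := by
        refine intervalIntegral.integral_mono_on hyb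
          ((hii y b (by linarith) hyb le_rfl).const_mul _) (h3.const_mul _) fun s hs => ?_
        have := h.mul_le_mul_shift (x := x) (z := s) (d := y - x) ⟨hax, by linarith⟩
          ⟨by linarith [hs.1], hs.2⟩ (by linarith) (by linarith [hs.1])
        simpa using this
    _ = f y * ∫ s in x..(b - (y - x)), f s := by
        rw [intervalIntegral.integral_const_mul, h1]
    _ ≤ _ := mul_le_mul_of_nonneg_left h2 hfy

end LogConcOn

lemma setIntegral_mul_le_setIntegral_mul_of_threshold {A B : Set ℝ} {f h : ℝ → ℝ} {k : ℝ}
    (hA : MeasurableSet A) (hB : MeasurableSet B)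
    (hfA : ∀ x ∈ A, 0 ≤ f x) (hfB : ∀ x ∈ B, 0 ≤ f x)
    (hAB : ∀ x ∈ A \ B, k ≤ h x) (hBA : ∀ x ∈ B \ A, h x ≤ k)
    (hiA : IntegrableOn f A) (hiB : IntegrableOn f B)
    (hhA : IntegrableOn (fun x => f x * h x) A) (hhB : IntegrableOn (fun x => f x * h x) B)
    (heq : ∫ x in A, f x = ∫ x in B, f x) :
    ∫ x in B, f x * h x ≤ ∫ x in A, f x * h x := by
  have e1 : ∀ S : Set ℝ, IntegrableOn f S → IntegrableOn (fun x => f x * h x) S →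
      IntegrableOn (fun x => f x * (h x - k)) S := fun S h1 h2 => by
    have := h2.sub (h1.mul_const k)
    refine this.congr (Filter.Eventually.of_forall fun x => ?_)
    simp only [Pi.sub_apply]; ring
  have e2 : ∀ S : Set ℝ, IntegrableOn f S → IntegrableOn (fun x => f x * h x) S →
      ∫ x in S, f x * (h x - k) = (∫ x in S, f x * h x) - (∫ x in S, f x) * k := fun S h1 h2 => by
    rw [← integral_mul_const, ← integral_sub h2 (h1.mul_const k)]
    congr 1; ext x; ring
  have a1 := integral_inter_add_sdiff hB (e1 A hiA hhA)
  have b1 := integral_inter_add_sdiff hA (e1 B hiB hhB)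
  rw [Set.inter_comm B A] at b1
  have a2 : 0 ≤ ∫ x in A \ B, f x * (h x - k) :=
    setIntegral_nonneg (hA.diff hB) fun x hx =>
      mul_nonneg (hfA x hx.1) (sub_nonneg.2 (hAB x hx))
  have b2 : ∫ x in B \ A, f x * (h x - k) ≤ 0 :=
    setIntegral_nonpos (hB.diff hA) fun x hx =>
      mul_nonpos_of_nonneg_of_nonpos (hfB x hx.1) (sub_nonpos.2 (hBA x hx))
  rw [e2 A hiA hhA] at a1
  rw [e2 B hiB hhB] at b1
  rw [heq] at a1
  linarith

lemma setIntegral_inter_le_of_density {w : ℝ → ℝ} {U : Set ℝ} {m q κ : ℝ} (hκ : 0 ≤ κ)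
    (hU : MeasurableSet U) (hw0 : ∀ x ∈ Set.Ioo m q, 0 ≤ w x)
    (hmono : MonotoneOn w (Set.Ioo m q)) (hwi : IntegrableOn w (Set.Ioo m q))
    (hdens : ∀ t ∈ Set.Icc m q, volume (U ∩ Set.Icc t q) ≤ ENNReal.ofReal (κ * (q - t))) :
    ∫ x in U ∩ Set.Ioo m q, w x ≤ κ * ∫ x in Set.Ioo m q, w x := by
  have hUm := hU.inter (measurableSet_Ioo (a := m) (b := q))
  have hwi' : IntegrableOn w (U ∩ Set.Ioo m q) := hwi.mono_set Set.inter_subset_right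
  have hn1 : 0 ≤ᵐ[volume.restrict (Set.Ioo m q)] w :=
    (ae_restrict_iff' measurableSet_Ioo).2 (Filter.Eventually.of_forall hw0)
  have hn2 : 0 ≤ᵐ[volume.restrict (U ∩ Set.Ioo m q)] w :=
    (ae_restrict_iff' hUm).2 (Filter.Eventually.of_forall fun x hx => hw0 x hx.2)
  have hI : 0 ≤ ∫ x in Set.Ioo m q, w x := setIntegral_nonneg measurableSet_Ioo hw0
  rw [← ENNReal.ofReal_le_ofReal_iff (mul_nonneg hκ hI), ENNReal.ofReal_mul hκ,
    ofReal_integral_eq_lintegral_ofReal hwi' hn2, ofReal_integral_eq_lintegral_ofReal hwi hn1,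
    lintegral_eq_lintegral_meas_lt _ hn1 hwi.aestronglyMeasurable.aemeasurable,
    lintegral_eq_lintegral_meas_lt _ hn2 hwi'.aestronglyMeasurable.aemeasurable,
    ← lintegral_const_mul' _ _ ENNReal.ofReal_ne_top]
  refine lintegral_mono fun h => ?_
  simp only [Measure.restrict_apply' hUm, Measure.restrict_apply' measurableSet_Ioo]
  rcases ({x | h < w x} ∩ Set.Ioo m q).eq_empty_or_nonempty with hS | hS
  · rw [Set.inter_left_comm, hS]; simp
  · set S := {x | h < w x} ∩ Set.Ioo m q with hSdef
    have hbdd : BddBelow S := ⟨m, fun x hx => hx.2.1.le⟩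
    have hm : m ≤ sInf S := le_csInf hS fun x hx => hx.2.1.le
    have hq : sInf S ≤ q := by
      obtain ⟨x, hx⟩ := hS
      exact (csInf_le hbdd hx).trans hx.2.2.le
    have h1 : {x | h < w x} ∩ (U ∩ Set.Ioo m q) ⊆ U ∩ Set.Icc (sInf S) q := fun x hx =>
      ⟨hx.2.1, csInf_le hbdd ⟨hx.1, hx.2.2⟩, hx.2.2.2.le⟩
    have h2 : Set.Ioo (sInf S) q ⊆ S := fun x hx => by
      obtain ⟨y, hy, hyx⟩ := (csInf_lt_iff hbdd hS).1 hx.1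
      have hxm : x ∈ Set.Ioo m q := ⟨hm.trans_lt hx.1, hx.2⟩
      exact ⟨lt_of_lt_of_le hy.1 (hmono hy.2 hxm hyx.le), hxm⟩
    calc volume ({x | h < w x} ∩ (U ∩ Set.Ioo m q)) ≤ ENNReal.ofReal (κ * (q - sInf S)) :=
          (measure_mono h1).trans (hdens _ ⟨hm, hq⟩)
      _ = ENNReal.ofReal κ * volume (Set.Ioo (sInf S) q) := by
          rw [ENNReal.ofReal_mul hκ, Real.volume_Ioo]
      _ ≤ _ := by gcongr

lemma measure_inter_le_of_connectedComponentIn {ν : Measure ℝ} {O U : Set ℝ} (hO : IsOpen O)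
    (hU : MeasurableSet U) (c : ENNReal)
    (h : ∀ x ∈ O, ν (U ∩ connectedComponentIn O x) ≤ c * ν (connectedComponentIn O x)) :
    ν (U ∩ O) ≤ c * ν O := by
  set 𝒞 : Set (Set ℝ) := connectedComponentIn O '' O with h𝒞
  have hopen : ∀ C ∈ 𝒞, IsOpen C := by
    rintro _ ⟨x, -, rfl⟩; exact hO.connectedComponentIn
  have hne : ∀ C ∈ 𝒞, C.Nonempty := by
    rintro _ ⟨x, hx, rfl⟩; exact ⟨x, mem_connectedComponentIn hx⟩
  have hdisj : 𝒞.PairwiseDisjoint id := by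
    rintro _ ⟨x, hx, rfl⟩ _ ⟨y, hy, rfl⟩ hxy
    refine Set.disjoint_left.2 fun z hz hz' => hxy ?_
    rw [connectedComponentIn_eq hz, connectedComponentIn_eq hz']
  have hcount : 𝒞.Countable := hdisj.countable_of_isOpen hopen hne
  have hunion : O = ⋃ C ∈ 𝒞, id C := by
    ext x
    simp only [Set.mem_iUnion, id, exists_prop]
    constructor
    · exact fun hx => ⟨_, ⟨x, hx, rfl⟩, mem_connectedComponentIn hx⟩
    · rintro ⟨_, ⟨y, -, rfl⟩, hx⟩
      exact connectedComponentIn_subset _ _ hx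
  have hνO : ν O = ∑' C : 𝒞, ν C := by
    conv_lhs => rw [hunion]
    exact measure_biUnion hcount hdisj fun C hC => (hopen C hC).measurableSet
  have hνU : ν (U ∩ O) = ∑' C : 𝒞, ν (U ∩ C) := by
    conv_lhs => rw [hunion, Set.inter_iUnion₂]
    refine measure_biUnion hcount (fun C hC D hD hCD => ?_)
      fun C hC => hU.inter (hopen C hC).measurableSet
    exact (hdisj hC hD hCD).mono Set.inter_subset_right Set.inter_subset_right
  rw [hνO, hνU, ← ENNReal.tsum_mul_left]
  refine ENNReal.tsum_le_tsum ?_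
  rintro ⟨_, x, hx, rfl⟩
  exact h x hx

/-- A connected component of an open subset of `(a, b)` is an interval whose end points lie
outside the open set. -/
lemma connectedComponentIn_eq_Ioo {O : Set ℝ} {a b x : ℝ} (hO : IsOpen O)
    (hab : O ⊆ Set.Ioo a b) (hx : x ∈ O) :
    ∃ p q, p ∈ Set.Icc a b ∧ q ∈ Set.Icc a b ∧ p < q ∧ p ∉ O ∧ q ∉ O ∧
      connectedComponentIn O x = Set.Ioo p q := by
  set C := connectedComponentIn O x with hC
  have hxC : x ∈ C := mem_connectedComponentIn hx
  have hCO : C ⊆ O := connectedComponentIn_subset _ _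
  have hCo : IsOpen C := hO.connectedComponentIn
  have hCc : IsPreconnected C := isPreconnected_connectedComponentIn
  have hne : C.Nonempty := ⟨x, hxC⟩
  have hlb : BddBelow C := ⟨a, fun y hy => (hab (hCO hy)).1.le⟩
  have hub : BddAbove C := ⟨b, fun y hy => (hab (hCO hy)).2.le⟩
  have hcl : ∀ y ∈ closure C, y ∈ O → y ∈ C := fun y hy hyO =>
    (hCc.subset_closure (Set.subset_insert y C)
      (Set.insert_subset hy subset_closure)).subset_connectedComponentIn
      (Set.mem_insert_of_mem _ hxC) (Set.insert_subset hyO hCO) (Set.mem_insert y C)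
  have hp : sInf C ∉ C := fun h => by
    obtain ⟨l, hl, hl'⟩ := exists_Ioc_subset_of_mem_nhds (hCo.mem_nhds h) ⟨sInf C - 1, by linarith⟩
    obtain ⟨y, hy1, hy2⟩ := exists_between hl
    exact absurd (csInf_le hlb (hl' ⟨hy1, hy2.le⟩)) (not_le.2 hy2)
  have hq : sSup C ∉ C := fun h => by
    obtain ⟨l, hl, hl'⟩ := exists_Ico_subset_of_mem_nhds (hCo.mem_nhds h) ⟨sSup C + 1, by linarith⟩
    obtain ⟨y, hy1, hy2⟩ := exists_between hl
    exact absurd (le_csSup hub (hl' ⟨hy1.le, hy2⟩)) (not_le.2 hy1)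
  have hpx : sInf C < x := lt_of_le_of_ne (csInf_le hlb hxC) fun h => hp (h ▸ hxC)
  have hxq : x < sSup C := lt_of_le_of_ne (le_csSup hub hxC) fun h => hq (h ▸ hxC)
  have hxab := hab hx
  refine ⟨sInf C, sSup C, ⟨le_csInf hne fun y hy => (hab (hCO hy)).1.le, by linarith [hxab.2]⟩,
    ⟨by linarith [hxab.1], csSup_le hne fun y hy => (hab (hCO hy)).2.le⟩, hpx.trans hxq,
    fun h => hp (hcl _ (csInf_mem_closure hne hlb) h),
    fun h => hq (hcl _ (csSup_mem_closure hne hub) h), Set.Subset.antisymm (fun y hy => ?_) ?_⟩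
  · exact ⟨lt_of_le_of_ne (csInf_le hlb hy) fun h => hp (h ▸ hy),
      lt_of_le_of_ne (le_csSup hub hy) fun h => hq (h ▸ hy)⟩
  · exact IsConnected.Ioo_csInf_csSup_subset ⟨hne, hCc⟩ hlb hub

namespace LogConcOn

variable {f : ℝ → ℝ} {U : Set ℝ} {a b κ : ℝ}

lemma setIntegral_le_of_right_density {m q : ℝ} (h : LogConcOn (Set.Icc m b) f)
    (hpos : ∀ x ∈ Set.Ioo m b, f x ≠ 0) (hi : IntegrableOn f (Set.Icc m b))
    (hκ : 0 < κ) (hmq : m ≤ q) (hqb : q ≤ b) (hU : MeasurableSet U)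
    (hdens : (∫ x in q..b, f x) = 0 ∨
      ∀ t ∈ Set.Icc m q, volume (U ∩ Set.Icc t q) ≤ ENNReal.ofReal (κ * (q - t))) :
    ∫ x in U ∩ Set.Ioo m q, f x ≤
      (∫ x in m..b, f x) * (1 - ((∫ x in q..b, f x) / ∫ x in m..b, f x) ^ κ) := by
  have hii : ∀ c d, m ≤ c → c ≤ d → d ≤ b → IntervalIntegrable f volume c d := fun c d h1 h2 h3 =>
    (intervalIntegrable_iff_integrableOn_Icc_of_le h2).2 (hi.mono_set (Set.Icc_subset_Icc h1 h3))
  have hadd : ∀ c d, m ≤ c → c ≤ d → d ≤ b →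
      (∫ x in c..d, f x) = (∫ x in c..b, f x) - ∫ x in d..b, f x := fun c d h1 h2 h3 => by
    rw [← intervalIntegral.integral_add_adjacent_intervals (hii c d h1 h2 h3)
      (hii d b (h1.trans h2) h3 le_rfl)]; ring
  have hioo : ∀ c d, c ≤ d → (∫ x in c..d, f x) = ∫ x in Set.Ioo c d, f x := fun c d h1 => by
    rw [intervalIntegral.integral_of_le h1, integral_Ioc_eq_integral_Ioo]
  have hUm := hU.inter (measurableSet_Ioo (a := m) (b := q))
  have hiq : IntegrableOn f (Set.Ioo m q) :=
    hi.mono_set (Set.Ioo_subset_Icc_self.trans (Set.Icc_subset_Icc_right hqb))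
  have hf0 : ∀ x ∈ Set.Ioo m q, 0 ≤ f x := fun x hx => h.1 x ⟨hx.1.le, hx.2.le.trans hqb⟩
  have hu : ∫ x in U ∩ Set.Ioo m q, f x ≤ ∫ x in m..q, f x := by
    rw [hioo m q hmq]
    exact setIntegral_mono_set hiq ((ae_restrict_iff' measurableSet_Ioo).2
      (Filter.Eventually.of_forall hf0)) Set.inter_subset_right.eventuallyLE
  have hu0 : 0 ≤ ∫ x in U ∩ Set.Ioo m q, f x := setIntegral_nonneg hUm fun x hx => hf0 x hx.2
  by_cases hq0 : (∫ x in q..b, f x) = 0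
  · rw [hq0, zero_div, Real.zero_rpow hκ.ne', sub_zero, mul_one]
    rw [hadd m q le_rfl hmq hqb, hq0] at hu
    linarith
  replace hdens := hdens.resolve_left hq0
  have hqb' : q < b := lt_of_le_of_ne hqb fun e => hq0 (by rw [e]; simp)
  set ψ : ℝ → ℝ := fun y => ∫ x in y..b, f x with hψ
  have hψpos : ∀ y ∈ Set.Icc m q, 0 < ψ y := fun y hy => by
    refine intervalIntegral.intervalIntegral_pos_of_pos_on
      (hii y b hy.1 (hy.2.trans hqb) le_rfl) (fun x hx => ?_) (hy.2.trans_lt hqb')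
    have hx' : x ∈ Set.Ioo m b := ⟨hy.1.trans_lt hx.1, hx.2⟩
    exact lt_of_le_of_ne (h.1 x (Set.Ioo_subset_Icc_self hx')) (hpos x hx').symm
  have hψanti : ∀ x ∈ Set.Icc m q, ∀ y ∈ Set.Icc m q, x ≤ y → ψ y ≤ ψ x := fun x hx y hy hxy => by
    have := hadd x y hx.1 hxy (hy.2.trans hqb)
    have h0 : 0 ≤ ∫ s in x..y, f s := intervalIntegral.integral_nonneg hxy fun s hs =>
      h.1 s ⟨hx.1.trans hs.1, hs.2.trans (hy.2.trans hqb)⟩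
    simp only [hψ]; linarith
  have hψcont : ContinuousOn ψ (Set.Icc m q) := by
    have := intervalIntegral.continuousOn_primitive_interval_left (f := f) (μ := volume)
      (a := m) (b := b) (by rwa [Set.uIcc_of_le (hmq.trans hqb)])
    rw [Set.uIcc_of_le (hmq.trans hqb)] at this
    exact this.mono (Set.Icc_subset_Icc_right hqb)
  have hfc := h.continuousOn hpos
  have hψderiv : ∀ y ∈ Set.Ioo m q, HasDerivAt ψ (-f y) y := fun y hy => by
    have hy' : y ∈ Set.Ioo m b := ⟨hy.1, hy.2.trans hqb'⟩
    refine intervalIntegral.integral_hasDerivAt_left (hii y b hy.1.le hy'.2.le le_rfl)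
      (hfc.stronglyMeasurableAtFilter isOpen_Ioo y hy') (hfc.continuousAt (isOpen_Ioo.mem_nhds hy'))
  have hinvc : ContinuousOn (fun y => (ψ y)⁻¹) (Set.Icc m q) :=
    hψcont.inv₀ fun y hy => (hψpos y hy).ne'
  have hwi : IntegrableOn (fun y => f y * (ψ y)⁻¹) (Set.Icc m q) :=
    (hi.mono_set (Set.Icc_subset_Icc_right hqb)).mul_continuousOn hinvc isCompact_Icc
  have hwlog : ∀ c ∈ Set.Icc m q,
      ∫ x in Set.Ioo m c, f x * (ψ x)⁻¹ = Real.log (ψ m) - Real.log (ψ c) := fun c hc => by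
    have hsub : Set.Icc m c ⊆ Set.Icc m q := Set.Icc_subset_Icc_right hc.2
    rw [← integral_Ioc_eq_integral_Ioo, ← intervalIntegral.integral_of_le hc.1]
    rw [intervalIntegral.integral_eq_sub_of_hasDerivAt_of_le hc.1
      (f := fun y => - Real.log (ψ y))]
    · ring
    · exact ((hψcont.mono hsub).log fun y hy => (hψpos y (hsub hy)).ne').neg
    · intro x hx
      have hxq : x ∈ Set.Ioo m q := ⟨hx.1, hx.2.trans_le hc.2⟩
      have := ((hψderiv x hxq).log (hψpos x (Set.Ioo_subset_Icc_self hxq)).ne').fun_neg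
      convert this using 1
      rw [div_eq_mul_inv]; ring
    · exact (intervalIntegrable_iff_integrableOn_Icc_of_le hc.1).2 (hwi.mono_set hsub)
  have hmm : m ∈ Set.Icc m q := ⟨le_rfl, hmq⟩
  have hqq : q ∈ Set.Icc m q := ⟨hmq, le_rfl⟩
  have hIooIcc : Set.Ioo m q ⊆ Set.Icc m q := Set.Ioo_subset_Icc_self
  obtain ⟨c, hc, hcu⟩ : (∫ x in m..b, f x) - ∫ x in U ∩ Set.Ioo m q, f x ∈ ψ '' Set.Icc m q := by
    refine intermediate_value_Icc' hmq hψcont ⟨?_, ?_⟩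
    · rw [hadd m q le_rfl hmq hqb] at hu
      simp only [hψ]; linarith
    · simp only [hψ]; linarith
  have hcioo : Set.Ioo m c ⊆ Set.Ioo m q := Set.Ioo_subset_Ioo_right hc.2
  have hbath : ∫ x in Set.Ioo m c, f x * (ψ x)⁻¹ ≤ ∫ x in U ∩ Set.Ioo m q, f x * (ψ x)⁻¹ := by
    refine setIntegral_mul_le_setIntegral_mul_of_threshold (k := (ψ c)⁻¹) hUm measurableSet_Ioo
      (fun x hx => hf0 x hx.2) (fun x hx => hf0 x (hcioo hx)) (fun x hx => ?_) (fun x hx => ?_)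
      (hiq.mono_set Set.inter_subset_right) (hiq.mono_set hcioo)
      (hwi.mono_set (Set.inter_subset_right.trans hIooIcc)) (hwi.mono_set (hcioo.trans hIooIcc)) ?_
    · have hx2 := hIooIcc hx.1.2
      have hcx : c ≤ x := not_lt.1 fun hlt => hx.2 ⟨hx.1.2.1, hlt⟩
      exact inv_anti₀ (hψpos x hx2) (hψanti c hc x hx2 hcx)
    · exact inv_anti₀ (hψpos c hc) (hψanti x (hIooIcc (hcioo hx.1)) c hc hx.1.2.le)
    · rw [← hioo m c hc.1, hadd m c le_rfl hc.1 (hc.2.trans hqb)]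
      have hcu' : (∫ x in c..b, f x) = _ := hcu
      rw [hcu']; ring
  have hmain : ∫ x in U ∩ Set.Ioo m q, f x * (ψ x)⁻¹ ≤
      κ * ∫ x in Set.Ioo m q, f x * (ψ x)⁻¹ := by
    refine setIntegral_inter_le_of_density hκ.le hU
      (fun x hx => mul_nonneg (hf0 x hx) (inv_nonneg.2 (hψpos x (hIooIcc hx)).le))
      (fun x hx y hy hxy => ?_) (hwi.mono_set hIooIcc) hdens
    have := h.mul_tail_le hi hx.1.le hxy (hy.2.le.trans hqb)
    simp only [← div_eq_mul_inv]
    rwa [div_le_div_iff₀ (hψpos x (hIooIcc hx)) (hψpos y (hIooIcc hy))]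
  have hlog := hbath.trans hmain
  rw [hwlog c hc, hwlog q hqq] at hlog
  have hm0 := hψpos m hmm
  have hq0' := hψpos q hqq
  have hc0 := hψpos c hc
  have key : ψ m * (ψ q / ψ m) ^ κ ≤ ψ c := by
    rw [← Real.log_le_log_iff (by positivity) hc0, Real.log_mul hm0.ne' (by positivity),
      Real.log_rpow (by positivity), Real.log_div hq0'.ne' hm0.ne']
    linarith
  have hcu' : ψ c = ψ m - ∫ x in U ∩ Set.Ioo m q, f x := hcu
  change _ ≤ ψ m * (1 - (ψ q / ψ m) ^ κ)
  linarith

lemma setIntegral_le_of_left_density {m p : ℝ} (h : LogConcOn (Set.Icc a m) f)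
    (hpos : ∀ x ∈ Set.Ioo a m, f x ≠ 0) (hi : IntegrableOn f (Set.Icc a m))
    (hκ : 0 < κ) (hap : a ≤ p) (hpm : p ≤ m) (hU : MeasurableSet U)
    (hdens : (∫ x in a..p, f x) = 0 ∨
      ∀ t ∈ Set.Icc p m, volume (U ∩ Set.Icc p t) ≤ ENNReal.ofReal (κ * (t - p))) :
    ∫ x in U ∩ Set.Ioo p m, f x ≤
      (∫ x in a..m, f x) * (1 - ((∫ x in a..p, f x) / ∫ x in a..m, f x) ^ κ) := by
  have hmp := Measure.measurePreserving_neg (volume : Measure ℝ)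
  have hme : MeasurableEmbedding (Neg.neg : ℝ → ℝ) := (MeasurableEquiv.neg ℝ).measurableEmbedding
  have hi' : IntegrableOn (fun x => f (-x)) (Set.Icc (-m) (-a)) := by
    have := (hmp.integrableOn_comp_preimage hme (f := f) (s := Set.Icc a m)).2 hi
    simpa [Function.comp_def] using this
  have := h.comp_neg.setIntegral_le_of_right_density (U := Neg.neg ⁻¹' U) (κ := κ) (q := -p)
    (fun x hx => hpos _ ⟨by linarith [hx.2], by linarith [hx.1]⟩) hi' hκ (by linarith)
    (by linarith) (hU.preimage measurable_neg) ?_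
  · simp only [intervalIntegral.integral_comp_neg, neg_neg] at this
    have e := hmp.setIntegral_preimage_emb hme f (U ∩ Set.Ioo p m)
    rw [← e]
    simpa using this
  · simp only [intervalIntegral.integral_comp_neg, neg_neg]
    refine hdens.imp_right fun hd t ht => ?_
    have h1 := hd (-t) ⟨by linarith [ht.2], by linarith [ht.1]⟩
    rw [← hmp.measure_preimage_emb hme] at h1
    convert h1 using 2
    · simp
    · ring

lemma setIntegral_le_of_two_sided_density {p q : ℝ} (h : LogConcOn (Set.Icc a b) f)
    (hpos : ∀ x ∈ Set.Ioo a b, f x ≠ 0) (hi : IntegrableOn f (Set.Icc a b))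
    (hM : 0 < ∫ x in a..b, f x)
    (hκ : 0 < κ) (hap : a ≤ p) (hpq : p ≤ q) (hqb : q ≤ b) (hU : MeasurableSet U)
    (hp : p = a ∨ ∀ t ∈ Set.Icc p q, volume (U ∩ Set.Icc p t) ≤ ENNReal.ofReal (κ * (t - p)))
    (hq : q = b ∨ ∀ t ∈ Set.Icc p q, volume (U ∩ Set.Icc t q) ≤ ENNReal.ofReal (κ * (q - t))) :
    ∫ x in U ∩ Set.Ioo p q, f x ≤
      (∫ x in a..b, f x) * (1 - (1 - (∫ x in p..q, f x) / ∫ x in a..b, f x) ^ κ) := by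
  have hab : a ≤ b := hap.trans (hpq.trans hqb)
  have hii : ∀ c d, a ≤ c → c ≤ d → d ≤ b → IntervalIntegrable f volume c d := fun c d h1 h2 h3 =>
    (intervalIntegrable_iff_integrableOn_Icc_of_le h2).2 (hi.mono_set (Set.Icc_subset_Icc h1 h3))
  have hnn : ∀ c d, a ≤ c → c ≤ d → d ≤ b → 0 ≤ ∫ x in c..d, f x := fun c d h1 h2 h3 =>
    intervalIntegral.integral_nonneg h2 fun s hs => h.1 s ⟨h1.trans hs.1, hs.2.trans h3⟩
  have hadd : ∀ c d e, a ≤ c → c ≤ d → d ≤ e → e ≤ b →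
      (∫ x in c..d, f x) + (∫ x in d..e, f x) = ∫ x in c..e, f x := fun c d e h1 h2 h3 h4 =>
    intervalIntegral.integral_add_adjacent_intervals (hii c d h1 h2 (h3.trans h4))
      (hii d e (h1.trans h2) h3 h4)
  set L := ∫ x in a..p, f x with hL
  set R := ∫ x in q..b, f x with hR
  set M := ∫ x in a..b, f x with hMdef
  have hL0 : 0 ≤ L := hnn a p le_rfl hap (hpq.trans hqb)
  have hR0 : 0 ≤ R := hnn q b (hap.trans hpq) hqb le_rfl
  obtain ⟨m, hm, hmeq⟩ : (0 : ℝ) ∈ (fun m => L * (∫ x in m..b, f x) - R * ∫ x in a..m, f x) ''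
      Set.Icc p q := by
    have hsub : Set.Icc p q ⊆ Set.uIcc a b := by
      rw [Set.uIcc_of_le hab]; exact Set.Icc_subset_Icc hap hqb
    have hi2 : IntegrableOn f (Set.uIcc a b) := by rwa [Set.uIcc_of_le hab]
    refine intermediate_value_Icc' hpq (((continuousOn_const.mul
      (intervalIntegral.continuousOn_primitive_interval_left hi2)).sub (continuousOn_const.mul
      (intervalIntegral.continuousOn_primitive_interval hi2))).mono hsub) ⟨?_, ?_⟩
    · have h1 := hadd a p q le_rfl hap hpq hqb
      have h2 := hnn p q hap hpq hqb
      change L * R - R * (∫ x in a..q, f x) ≤ 0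
      rw [← h1]
      nlinarith
    · have h1 := hadd p q b hap hpq hqb le_rfl
      have h2 := hnn p q hap hpq hqb
      change 0 ≤ L * (∫ x in p..b, f x) - R * L
      rw [← h1]
      nlinarith
  have hLm := hadd a m b le_rfl (hap.trans hm.1) (hm.2.trans hqb) le_rfl
  have hLm0 := hnn a m le_rfl (hap.trans hm.1) (hm.2.trans hqb)
  have hRm0 := hnn m b (hap.trans hm.1) (hm.2.trans hqb) le_rfl
  have hsum : L + (∫ x in p..q, f x) + R = M := by
    rw [hL, hR, hadd a p q le_rfl hap hpq hqb, hadd a q b le_rfl (hap.trans hpq) hqb le_rfl]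
  have hr := h.mono (Set.Icc_subset_Icc_left (hap.trans hm.1))
    |>.setIntegral_le_of_right_density (U := U) (κ := κ) (q := q)
    (fun x hx => hpos x ⟨(hap.trans hm.1).trans_lt hx.1, hx.2⟩)
    (hi.mono_set (Set.Icc_subset_Icc_left (hap.trans hm.1))) hκ hm.2 hqb hU
    (hq.imp (fun e => by rw [e]; simp) fun hd t ht => hd t ⟨hm.1.trans ht.1, ht.2⟩)
  have hl := h.mono (Set.Icc_subset_Icc_right (hm.2.trans hqb))
    |>.setIntegral_le_of_left_density (U := U) (κ := κ) (p := p)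
    (fun x hx => hpos x ⟨hx.1, hx.2.trans_le (hm.2.trans hqb)⟩)
    (hi.mono_set (Set.Icc_subset_Icc_right (hm.2.trans hqb))) hκ hap hm.1 hU
    (hp.imp (fun e => by rw [e]; simp) fun hd t ht => hd t ⟨ht.1, ht.2.trans hm.2⟩)
  have hsplit : ∫ x in U ∩ Set.Ioo p q, f x =
      (∫ x in U ∩ Set.Ioo p m, f x) + ∫ x in U ∩ Set.Ioo m q, f x := by
    have e1 : (U ∩ Set.Ioo p q : Set ℝ) =ᵐ[volume] (U ∩ Set.Ioc p q : Set ℝ) :=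
      (Filter.EventuallyEq.refl _ _).inter Ioo_ae_eq_Ioc
    have e2 : (U ∩ Set.Ioo p m : Set ℝ) =ᵐ[volume] (U ∩ Set.Ioc p m : Set ℝ) :=
      (Filter.EventuallyEq.refl _ _).inter Ioo_ae_eq_Ioc
    have e3 : (U ∩ Set.Ioo m q : Set ℝ) =ᵐ[volume] (U ∩ Set.Ioc m q : Set ℝ) :=
      (Filter.EventuallyEq.refl _ _).inter Ioo_ae_eq_Ioc
    rw [setIntegral_congr_set e1, setIntegral_congr_set e2, setIntegral_congr_set e3,
      ← Set.Ioc_union_Ioc_eq_Ioc hm.1 hm.2, Set.inter_union_distrib_left]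
    refine setIntegral_union ?_ (hU.inter measurableSet_Ioc) ?_ ?_
    · exact (Set.Ioc_disjoint_Ioc_of_le le_rfl).mono Set.inter_subset_right Set.inter_subset_right
    · exact hi.mono_set fun x hx => ⟨hap.trans hx.2.1.le, hx.2.2.trans (hm.2.trans hqb)⟩
    · exact hi.mono_set fun x hx => ⟨(hap.trans hm.1).trans hx.2.1.le, hx.2.2.trans hqb⟩
  have hmeq' : L * (∫ x in m..b, f x) = R * ∫ x in a..m, f x := sub_eq_zero.1 hmeq
  set Lm := ∫ x in a..m, f x with hLmdef
  set Rm := ∫ x in m..b, f x with hRmdef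
  have hfrac : 1 - (∫ x in p..q, f x) / M = (L + R) / M := by
    rw [← hsum] at hM ⊢; field_simp; ring
  have e1 : Lm * (1 - (L / Lm) ^ κ) = Lm * (1 - ((L + R) / M) ^ κ) := by
    rcases hLm0.eq_or_lt with e | e
    · rw [← e]; simp
    · have : L / Lm = (L + R) / M := by
        rw [div_eq_div_iff e.ne' hM.ne', hMdef, ← hLm]; linarith
      rw [this]
  have e2 : Rm * (1 - (R / Rm) ^ κ) = Rm * (1 - ((L + R) / M) ^ κ) := by
    rcases hRm0.eq_or_lt with e | e
    · rw [← e]; simp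
    · have : R / Rm = (L + R) / M := by
        rw [div_eq_div_iff e.ne' hM.ne', hMdef, ← hLm]; linarith
      rw [this]
  rw [← hL, e1] at hl
  rw [← hR, e2] at hr
  have hML : M * (1 - ((L + R) / M) ^ κ) =
      Lm * (1 - ((L + R) / M) ^ κ) + Rm * (1 - ((L + R) / M) ^ κ) := by
    rw [← add_mul, hLm]
  rw [hfrac, hsplit, hML]
  linarith

end LogConcOn

/-- The points `x ∈ [a, b]` such that every interval `[c, d] ⊆ [a, b]` containing `x` meets `U` in
proportion at most `κ`, expressed through arbitrary `[c, d]` to make the condition closed in `x`. -/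
def lowDensityPoints (U : Set ℝ) (a b κ : ℝ) : Set ℝ :=
  {x | x ∈ Set.Icc a b ∧ ∀ c ∈ Set.Icc a b, ∀ d ∈ Set.Icc a b,
    (volume (U ∩ Set.Icc c d)).toReal ≤ κ * (max d x - min c x)}

namespace lowDensityPoints

variable {U : Set ℝ} {a b κ : ℝ}

protected lemma isClosed : IsClosed (lowDensityPoints U a b κ) := by
  simp only [lowDensityPoints, Set.ofPred_and, Set.ofPred_forall]
  refine isClosed_Icc.inter ?_
  refine isClosed_biInter fun c _ => isClosed_biInter fun d _ => ?_
  exact isClosed_le continuous_const (by fun_prop)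

lemma volume_inter_Icc_le {x c d : ℝ} (hx : x ∈ lowDensityPoints U a b κ) (hac : a ≤ c)
    (hdb : d ≤ b) (hxc : c ≤ x) (hxd : x ≤ d) :
    volume (U ∩ Set.Icc c d) ≤ ENNReal.ofReal (κ * (d - c)) := by
  have := hx.2 c ⟨hac, by linarith⟩ d ⟨by linarith, hdb⟩
  rw [max_eq_left hxd, min_eq_left hxc] at this
  exact (ENNReal.le_ofReal_iff_toReal_le
    (measure_ne_top_of_subset Set.inter_subset_right isCompact_Icc.measure_lt_top.ne)
    (ENNReal.toReal_nonneg.trans this)).2 this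

lemma volume_inter_inter_Ioo_eq_zero (hκ : κ < 1) :
    volume (U ∩ lowDensityPoints U a b κ ∩ Set.Ioo a b) = 0 := by
  have h := Besicovitch.ae_tendsto_measure_inter_div (volume : Measure ℝ) U
  have h' := ae_imp_of_ae_restrict h
  refine measure_mono_null (fun x hx => ?_) h'
  intro hlim
  have hlim := hlim hx.1.1
  have hr : ∀ᶠ r in nhdsWithin (0 : ℝ) (Set.Ioi 0),
      volume (U ∩ Metric.closedBall x r) / volume (Metric.closedBall x r) ≤ ENNReal.ofReal κ := by
    have hmin : (0 : ℝ) < min (x - a) (b - x) :=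
      lt_min (by linarith [hx.2.1]) (by linarith [hx.2.2])
    filter_upwards [Ioo_mem_nhdsGT hmin] with r hr
    have h1 := hr.2.trans_le (min_le_left _ _)
    have h2 := hr.2.trans_le (min_le_right _ _)
    have hr0 := hr.1
    have := volume_inter_Icc_le hx.1.2 (c := x - r) (d := x + r) (by linarith) (by linarith)
      (by linarith) (by linarith)
    rw [Real.closedBall_eq_Icc, Real.volume_Icc]
    refine ENNReal.div_le_of_le_mul (this.trans_eq ?_)
    rw [← ENNReal.ofReal_mul' (by linarith)]
  exact absurd (le_of_tendsto hlim hr) (by simpa using hκ)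

end lowDensityPoints

lemma core1_subset_lowDensityPoints {E : Set ℝ} {a b lam : ℝ} (hE : MeasurableSet E)
    (hEI : E ⊆ Set.Icc a b) (hlam : 1 < lam) :
    core1 E (Set.Icc a b) lam ⊆ lowDensityPoints (Set.Icc a b \ E) a b lam⁻¹ := by
  intro x hx
  have hxI := hEI hx.1
  refine ⟨hxI, fun c hc d hd => ?_⟩
  have hc' : min c x ∈ Set.Icc a b := ⟨le_min hc.1 hxI.1, (min_le_right _ _).trans hxI.2⟩
  have hd' : max d x ∈ Set.Icc a b := ⟨hxI.1.trans (le_max_right _ _), max_le hd.2 hxI.2⟩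
  have hsub : Set.Icc (min c x) (max d x) ⊆ Set.Icc a b := Set.Icc_subset_Icc hc'.1 hd'.2
  have h1 := hx.2 _ _ ⟨min_le_right _ _, le_max_right _ _⟩ hsub
  have hle : min c x ≤ max d x := (min_le_right _ _).trans (le_max_right _ _)
  set J := Set.Icc (min c x) (max d x) with hJ
  have hfin : ∀ s : Set ℝ, volume (s ∩ J) ≠ ⊤ := fun s =>
    measure_ne_top_of_subset Set.inter_subset_right isCompact_Icc.measure_lt_top.ne
  have h2 : (volume (E ∩ J)).toReal + (volume ((Set.Icc a b \ E) ∩ J)).toReal =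
      max d x - min c x := by
    rw [← ENNReal.toReal_add (hfin _) (hfin _),
      show (Set.Icc a b \ E) ∩ J = J \ E by
        ext y; exact ⟨fun h => ⟨h.2, h.1.2⟩, fun h => ⟨⟨hsub h.1, h.2⟩, h.1⟩⟩,
      Set.inter_comm, measure_inter_add_sdiff _ hE, hJ, Real.volume_Icc,
      ENNReal.toReal_ofReal (by linarith)]
  have h3 : (volume ((Set.Icc a b \ E) ∩ Set.Icc c d)).toReal ≤
      (volume ((Set.Icc a b \ E) ∩ J)).toReal :=
    ENNReal.toReal_mono (hfin _) (measure_mono (Set.inter_subset_inter_right _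
      (Set.Icc_subset_Icc (min_le_left _ _) (le_max_left _ _))))
  have h4 : (lam - 1) / lam = 1 - lam⁻¹ := by field_simp
  rw [h4] at h1
  linarith

theorem KLS_one_dimensional (a b : ℝ) (hab : a ≤ b) (f : ℝ → ℝ)
    (hf0 : ∀ x ∈ Set.Icc a b, 0 ≤ f x)
    (hflc : ∀ x ∈ Set.Icc a b, ∀ y ∈ Set.Icc a b, ∀ t ∈ Set.Icc (0 : ℝ) 1,
      f x ^ t * f y ^ (1 - t) ≤ f (t * x + (1 - t) * y))
    (hfpos : ∀ x ∈ Set.Ioo a b, f x ≠ 0)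
    (E : Set ℝ) (hE : MeasurableSet E) (hEI : E ⊆ Set.Icc a b)
    (lam : ℝ) (hlam : 1 < lam) :
    (∫ x in core1 E (Set.Icc a b) lam, f x) / (∫ x in Set.Icc a b, f x) ≤
      ((∫ x in E, f x) / (∫ x in Set.Icc a b, f x)) ^ lam := by
  have hlam0 : 0 < lam := by linarith
  by_cases hM0 : ∫ x in Set.Icc a b, f x = 0
  · simp [hM0, Real.zero_rpow hlam0.ne']
  have hi : IntegrableOn f (Set.Icc a b) := by
    by_contra h
    exact hM0 (integral_undef h)
  have hM : 0 < ∫ x in Set.Icc a b, f x :=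
    lt_of_le_of_ne (setIntegral_nonneg measurableSet_Icc hf0) (Ne.symm hM0)
  have h : LogConcOn (Set.Icc a b) f := ⟨hf0, hflc⟩
  have hMi : ∫ x in a..b, f x = ∫ x in Set.Icc a b, f x := by
    rw [intervalIntegral.integral_of_le hab, integral_Icc_eq_integral_Ioc]
  set M := ∫ x in Set.Icc a b, f x with hMdef
  set κ := lam⁻¹ with hκdef
  have hκ : 0 < κ := inv_pos.2 hlam0
  have hκ1 : κ < 1 := inv_lt_one_of_one_lt₀ hlam
  set U := Set.Icc a b \ E with hUdef
  have hU : MeasurableSet U := measurableSet_Icc.diff hE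
  set F := lowDensityPoints U a b κ with hF
  set O := Set.Ioo a b \ F with hOdef
  have hO : IsOpen O := isOpen_Ioo.sdiff lowDensityPoints.isClosed
  have hOI : O ⊆ Set.Ioo a b := Set.sdiff_subset
  have hOI' : O ⊆ Set.Icc a b := hOI.trans Set.Ioo_subset_Icc_self
  have hmono : ∀ A B : Set ℝ, MeasurableSet B → B ⊆ Set.Icc a b → A ⊆ B →
      ∫ x in A, f x ≤ ∫ x in B, f x := fun A B hB hBI hAB =>
    setIntegral_mono_set (hi.mono_set hBI) ((ae_restrict_iff' hB).2
      (Filter.Eventually.of_forall fun x hx => hf0 x (hBI hx))) hAB.eventuallyLE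
  have hnn : ∀ A : Set ℝ, MeasurableSet A → A ⊆ Set.Icc a b → 0 ≤ ∫ x in A, f x :=
    fun A hA hAI => setIntegral_nonneg hA fun x hx => hf0 x (hAI hx)
  set S := ∫ x in O, f x with hS
  have hS0 : 0 ≤ S := hnn O hO.measurableSet hOI'
  have hSM : S ≤ M := hmono O _ measurableSet_Icc subset_rfl hOI'
  have hSM1 : S / M ≤ 1 := (div_le_one hM).2 hSM
  set y := (1 - S / M) ^ κ with hy
  have hy0 : 0 ≤ y := Real.rpow_nonneg (by linarith) _
  have hy1 : y ≤ 1 := Real.rpow_le_one (by linarith)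
    (by linarith [div_nonneg hS0 hM.le]) hκ.le
  set c : ℝ := M * (1 - y) / S with hc
  have hc0 : 0 ≤ c := div_nonneg (mul_nonneg hM.le (by linarith)) hS0
  have hcomp : ∀ x ∈ O, ∫ x in U ∩ connectedComponentIn O x, f x ≤
      c * ∫ x in connectedComponentIn O x, f x := by
    intro x hx
    obtain ⟨p, q, hp, hq, hpq, hpO, hqO, hC⟩ := connectedComponentIn_eq_Ioo hO hOI hx
    have hCO : Set.Ioo p q ⊆ O := hC ▸ connectedComponentIn_subset O x
    rw [hC]
    have hpF : p = a ∨ p ∈ F := by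
      refine or_iff_not_imp_left.2 fun hpa => by_contra fun hpF => hpO ⟨⟨?_, ?_⟩, hpF⟩
      · exact lt_of_le_of_ne hp.1 (Ne.symm hpa)
      · exact hpq.trans_le hq.2
    have hqF : q = b ∨ q ∈ F := by
      refine or_iff_not_imp_left.2 fun hqb => by_contra fun hqF => hqO ⟨⟨?_, ?_⟩, hqF⟩
      · exact hp.1.trans_lt hpq
      · exact lt_of_le_of_ne hq.2 hqb
    have key := h.setIntegral_le_of_two_sided_density (U := U) (κ := κ) hfpos hi (hMi ▸ hM) hκ
      hp.1 hpq.le hq.2 hU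
      (hpF.imp_right fun hpF t ht => lowDensityPoints.volume_inter_Icc_le hpF hp.1
        (ht.2.trans hq.2) le_rfl ht.1)
      (hqF.imp_right fun hqF t ht => lowDensityPoints.volume_inter_Icc_le hqF (hp.1.trans ht.1)
        hq.2 ht.2 le_rfl)
    rw [hMi, intervalIntegral.integral_of_le hpq.le, integral_Ioc_eq_integral_Ioo] at key
    set B := ∫ x in Set.Ioo p q, f x with hB
    have hB0 : 0 ≤ B := hnn _ measurableSet_Ioo (hCO.trans hOI')
    have hBS : B ≤ S := hmono _ O hO.measurableSet hOI' hCO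
    refine key.trans ?_
    rcases hS0.eq_or_lt with hS00 | hSpos
    · have : B = 0 := by linarith
      simp [this]
    · have hθ1 : B / S ≤ 1 := (div_le_one hSpos).2 hBS
      have hθ0 : 0 ≤ B / S := div_nonneg hB0 hS0
      have hconc := (Real.concaveOn_rpow hκ.le hκ1.le).2 (Set.mem_Ici.2 zero_le_one)
        (Set.mem_Ici.2 (sub_nonneg.2 hSM1)) (sub_nonneg.2 hθ1) hθ0 (sub_add_cancel 1 (B / S))
      simp only [smul_eq_mul, Real.one_rpow, mul_one] at hconc
      rw [show 1 - B / S + B / S * (1 - S / M) = 1 - B / M by field_simp; ring] at hconc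
      have : c * B = M * (B / S * (1 - y)) := by rw [hc]; field_simp
      rw [this]
      refine mul_le_mul_of_nonneg_left ?_ hM.le
      linarith
  have hν : ∀ A : Set ℝ, MeasurableSet A → A ⊆ Set.Icc a b →
      volume.withDensity (fun x => ENNReal.ofReal (f x)) A = ENNReal.ofReal (∫ x in A, f x) :=
    fun A hA hAI => by
      rw [withDensity_apply _ hA, ofReal_integral_eq_lintegral_ofReal (hi.mono_set hAI)]
      exact (ae_restrict_iff' hA).2 (Filter.Eventually.of_forall fun x hx => hf0 x (hAI hx))
  have hUO : ∫ x in U ∩ O, f x ≤ c * S := by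
    have := measure_inter_le_of_connectedComponentIn
      (ν := volume.withDensity fun x => ENNReal.ofReal (f x)) hO hU (ENNReal.ofReal c)
      fun x hx => by
        have hCm : MeasurableSet (connectedComponentIn O x) := hO.connectedComponentIn.measurableSet
        have hCI := (connectedComponentIn_subset O x).trans hOI'
        rw [hν _ (hU.inter hCm) (Set.inter_subset_right.trans hCI), hν _ hCm hCI,
          ← ENNReal.ofReal_mul hc0]
        exact ENNReal.ofReal_le_ofReal (hcomp x hx)
    rw [hν _ (hU.inter hO.measurableSet) (Set.inter_subset_right.trans hOI'),
      hν _ hO.measurableSet hOI', ← ENNReal.ofReal_mul hc0,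
      ENNReal.ofReal_le_ofReal_iff (mul_nonneg hc0 hS0)] at this
    exact this
  have hcS : c * S = M * (1 - y) := by
    rcases hS0.eq_or_lt with hS00 | hSpos
    · rw [hy, ← hS00]; simp
    · rw [hc]; field_simp
  have hUae : ∫ x in U, f x = ∫ x in U ∩ O, f x := by
    refine setIntegral_congr_set (Filter.EventuallyEq.symm ?_)
    refine Filter.EventuallyLE.antisymm Set.inter_subset_left.eventuallyLE ?_
    rw [ae_le_set]
    refine measure_mono_null (t := (U ∩ F ∩ Set.Ioo a b) ∪ {a, b}) (fun x hx => ?_) ?_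
    · by_cases hxab : x ∈ Set.Ioo a b
      · exact Or.inl ⟨⟨hx.1, by_contra fun hxF => hx.2 ⟨hx.1, hxab, hxF⟩⟩, hxab⟩
      · refine Or.inr ?_
        have hxI := hx.1.1
        rcases hxI.1.eq_or_lt with e | e
        · exact Or.inl e.symm
        · exact Or.inr (le_antisymm hxI.2 (not_lt.1 fun h' => hxab ⟨e, h'⟩))
    · refine measure_union_null (lowDensityPoints.volume_inter_inter_Ioo_eq_zero hκ1) ?_
      exact (Set.toFinite {a, b}).measure_zero _
  have hEU : (∫ x in E, f x) + ∫ x in U, f x = M := by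
    have := integral_inter_add_sdiff hE hi
    rwa [Set.inter_eq_self_of_subset_right hEI] at this
  have hcore : ∫ x in core1 E (Set.Icc a b) lam, f x ≤ M - S := by
    have h1 := hmono (core1 E (Set.Icc a b) lam) (Set.Icc a b \ O)
      (measurableSet_Icc.diff hO.measurableSet) Set.sdiff_subset
      fun x hx => ⟨hEI hx.1, fun hxO => hxO.2 (core1_subset_lowDensityPoints hE hEI hlam hx)⟩
    have h2 := integral_inter_add_sdiff hO.measurableSet hi
    rw [Set.inter_eq_self_of_subset_right hOI'] at h2
    linarith
  have hyE : y ≤ (∫ x in E, f x) / M := by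
    rw [le_div_iff₀ hM]
    linarith
  calc (∫ x in core1 E (Set.Icc a b) lam, f x) / M ≤ (M - S) / M := by gcongr
    _ = y ^ lam := by
        rw [hy, hκdef, Real.rpow_inv_rpow (by linarith) hlam0.ne', sub_div, div_self hM.ne']
    _ ≤ _ := Real.rpow_le_rpow hy0 hyE hlam0.le
end
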